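/- (Approximation of Sobolev functions away from the trifling region) Let d ≥ 1, b ≥ 2 an integer, 0 < s < 1, 1 ≤ q < ∞ and q ≤ p ≤ ∞ with 1/q − 1/p < s/d (with 1/∞ = 0), and set κ = s/(s + d/p − d/q) ∈ [1,∞). Then there exists a constant C > 0 depending only on p, q, s, d and b such that the following holds. For any α, β ∈ ℕ with α, β ≥ 1, set ℓ* = ⌊2κ(α+β)⌋ and let 0 < ε < b^{−ℓ*}. For every measurable f : [0,1]^d → ℝ with ‖f‖_{W^{s,q}([0,1]^d)} ≤ 1, there exist W, L ∈ ℕ with W ≤ C·b^{dα} and L ≤ C·b^{dβ}, and g ∈ NN_{d,1}(W, L), such that ‖f − g‖_{L^p(Ω_{ℓ*,ε})} ≤ C·b^{−2s(α+β)}. -/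

import Mathlib

open MeasureTheory ENNReal Finset

noncomputable section

/-- The ReLU activation function. -/
def relu (t : ℝ) : ℝ := max t 0

/-- `A` is an affine map `ℝ^n → ℝ^m`. -/
def IsAffineMap {n m : ℕ} (A : (Fin n → ℝ) → (Fin m → ℝ)) : Prop :=
  ∃ (M : Matrix (Fin m) (Fin n) ℝ) (c : Fin m → ℝ),
    ∀ x i, A x i = (∑ j, M i j * x j) + c i

/-- Auxiliary definition of the ReLU network class, by recursion on the number
of hidden layers. -/
def NNaux (k W : ℕ) : ℕ → (d : ℕ) → Set ((Fin d → ℝ) → (Fin k → ℝ))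
  | 0, _ => {g | IsAffineMap g}
  | (L + 1), d => {g | ∃ N : ℕ, 1 ≤ N ∧ N ≤ W ∧
      ∃ (A : (Fin d → ℝ) → (Fin N → ℝ)) (h : (Fin N → ℝ) → (Fin k → ℝ)),
        IsAffineMap A ∧ h ∈ NNaux k W L N ∧
        g = fun x => h (fun i => relu (A x i))}

/-- The class `NN_{d,k}(W,L)` of functions `ℝ^d → ℝ^k` computed by fully connected
ReLU networks with width at most `W` and `L` hidden layers. -/
def NN (d k W L : ℕ) : Set ((Fin d → ℝ) → (Fin k → ℝ)) := NNaux k W L d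


/-- The trimmed subcube `Ω_{i,ε}^ℓ` of the partition of `[0,1)^d` into `b^{dℓ}`
subcubes, where a strip of width `ε` is removed on the right of each coordinate
(except for the last subcube in each coordinate). -/
def trimmedCell (d b ℓ : ℕ) (ε : ℝ) (i : Fin d → ℕ) : Set (Fin d → ℝ) :=
  {x | ∀ j, if i j < b ^ ℓ - 1
      then (i j : ℝ) / (b : ℝ) ^ ℓ ≤ x j ∧ x j < ((i j : ℝ) + 1) / (b : ℝ) ^ ℓ - ε
      else 1 - ((b : ℝ) ^ ℓ)⁻¹ ≤ x j ∧ x j < 1}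

/-- The good region `Ω_{ℓ,ε}`, the union of all trimmed subcubes. -/
def goodRegion (d b ℓ : ℕ) (ε : ℝ) : Set (Fin d → ℝ) :=
  ⋃ i ∈ {i : Fin d → ℕ | ∀ j, i j < b ^ ℓ}, trimmedCell d b ℓ ε i

/-- The unit cube `[0,1]^d`. -/
def unitCube (d : ℕ) : Set (Fin d → ℝ) := Set.Icc 0 1

/-- The fractional Sobolev (Sobolev–Slobodeckij) norm
`‖f‖_{W^{s,q}([0,1]^d)} = (‖f‖_{L^q}^q + ∫∫ |f x − f y|^q / |x−y|^{d+sq} dx dy)^{1/q}`,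
where `|x−y|` is the Euclidean distance. The value is `∞` if `f` is not in the space. -/
def sobNorm (d : ℕ) (s q : ℝ) (f : (Fin d → ℝ) → ℝ) : ℝ≥0∞ :=
  ((∫⁻ x in unitCube d, ENNReal.ofReal (|f x| ^ q)) +
    ∫⁻ x in unitCube d, ∫⁻ y in unitCube d,
      ENNReal.ofReal
        (|f x - f y| ^ q / Real.sqrt (∑ j, (x j - y j) ^ 2) ^ ((d : ℝ) + s * q))) ^ (1 / q)

/-- The affine span of a family of real functions: its linear span together with the constants. -/
def affSpan {X J : Type*} (A : J → X → ℝ) : Submodule ℝ (X → ℝ) :=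
  Submodule.span ℝ (insert (fun _ => 1) (Set.range A))

section affSpan

variable {X J J' : Type*} {A : J → X → ℝ}

lemma mem_affSpan (j : J) : A j ∈ affSpan A :=
  Submodule.subset_span (Set.mem_insert_of_mem _ ⟨j, rfl⟩)

lemma const_mem_affSpan (c : ℝ) : (fun _ => c) ∈ affSpan A := by
  have h : (fun _ => 1 : X → ℝ) ∈ affSpan A := Submodule.subset_span (Set.mem_insert _ _)
  have := (affSpan A).smul_mem c h
  convert this using 1
  ext; simp

lemma add_mem_affSpan {φ ψ : X → ℝ} (hφ : φ ∈ affSpan A) (hψ : ψ ∈ affSpan A) :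
    (fun x => φ x + ψ x) ∈ affSpan A := (affSpan A).add_mem hφ hψ

lemma sub_mem_affSpan {φ ψ : X → ℝ} (hφ : φ ∈ affSpan A) (hψ : ψ ∈ affSpan A) :
    (fun x => φ x - ψ x) ∈ affSpan A := (affSpan A).sub_mem hφ hψ

lemma neg_mem_affSpan {φ : X → ℝ} (hφ : φ ∈ affSpan A) :
    (fun x => - φ x) ∈ affSpan A := (affSpan A).neg_mem hφ

lemma mul_mem_affSpan {φ : X → ℝ} (c : ℝ) (hφ : φ ∈ affSpan A) :
    (fun x => c * φ x) ∈ affSpan A := (affSpan A).smul_mem c hφ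

lemma sum_mem_affSpan {K : Type*} (s : Finset K) {φ : K → X → ℝ}
    (hφ : ∀ k ∈ s, φ k ∈ affSpan A) : (fun x => ∑ k ∈ s, φ k x) ∈ affSpan A := by
  have := (affSpan A).sum_mem hφ
  convert this using 1
  ext; simp

lemma affSpan_le {A' : J' → X → ℝ} (h : ∀ j, A' j ∈ affSpan A) : affSpan A' ≤ affSpan A := by
  refine Submodule.span_le.2 (Set.insert_subset (const_mem_affSpan 1) ?_)
  rintro _ ⟨j, rfl⟩
  exact h j

lemma exists_coeff_of_mem_affSpan [Fintype J] {φ : X → ℝ} (h : φ ∈ affSpan A) :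
    ∃ (m : J → ℝ) (c : ℝ), ∀ x, φ x = (∑ j, m j * A j x) + c := by
  classical
  refine Submodule.span_induction (p := fun φ _ => ∃ (m : J → ℝ) (c : ℝ), ∀ x,
    φ x = (∑ j, m j * A j x) + c) ?_ ?_ ?_ ?_ h
  · rintro φ (rfl | ⟨j, rfl⟩)
    · exact ⟨0, 1, fun x => by simp⟩
    · exact ⟨Pi.single j 1, 0, fun x => by simp [Pi.single_apply]⟩
  · exact ⟨0, 0, fun x => by simp⟩
  · rintro φ ψ - - ⟨m, c, h⟩ ⟨m', c', h'⟩
    refine ⟨m + m', c + c', fun x => ?_⟩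
    simp only [Pi.add_apply, h, h', add_mul, sum_add_distrib]
    ring
  · rintro a φ - ⟨m, c, h⟩
    refine ⟨a • m, a * c, fun x => ?_⟩
    simp only [Pi.smul_apply, smul_eq_mul, h, mul_add, mul_sum, mul_assoc]

end affSpan

/-- `Neurons ξ W L N a`: the family `a` lists the `N` neurons in the `L`-th hidden layer of some
ReLU network of width at most `W` whose inputs are the functions `ξ`. -/
inductive Neurons {X : Type*} {d : ℕ} (ξ : Fin d → X → ℝ) (W : ℕ) :
    ℕ → (N : ℕ) → (Fin N → X → ℝ) → Prop
  | input : Neurons ξ W 0 d ξ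
  | layer {L N M : ℕ} {a : Fin N → X → ℝ} {T : Fin M → X → ℝ} : Neurons ξ W L N a → 1 ≤ M →
      M ≤ W → (∀ j, T j ∈ affSpan a) → Neurons ξ W (L + 1) M (fun j x => relu (T j x))

lemma Neurons.exists_network {X : Type*} {d W L N : ℕ} {ξ : Fin d → X → ℝ} {a : Fin N → X → ℝ}
    (h : Neurons ξ W L N a) {k L' : ℕ} {f : (Fin N → ℝ) → (Fin k → ℝ)} (hf : f ∈ NNaux k W L' N) :
    ∃ g ∈ NNaux k W (L + L') d, ∀ x, g (fun i => ξ i x) = f (fun i => a i x) := by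
  induction h generalizing L' with
  | input => exact ⟨f, by simpa using hf, fun x => rfl⟩
  | @layer L N M a T _ hM hMW hT ih =>
    choose m c hmc using fun j => exists_coeff_of_mem_affSpan (hT j)
    let A : (Fin N → ℝ) → (Fin M → ℝ) := fun y i => (∑ j, m i j * y j) + c i
    obtain ⟨g, hg, hgx⟩ := ih (L' := L' + 1) (f := fun y => f (fun i => relu (A y i)))
      ⟨M, hM, hMW, A, f, ⟨m, c, fun _ _ => rfl⟩, hf, rfl⟩
    refine ⟨g, by rwa [add_assoc, add_comm 1], fun x => ?_⟩
    rw [hgx]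
    simp only [A, hmc]

/-- The functions `A j` can all be read off affinely from the `L`-th hidden layer of some ReLU
network of width at most `W` with inputs `ξ`. -/
def Computes {X J : Type*} {d : ℕ} (ξ : Fin d → X → ℝ) (W L : ℕ) (A : J → X → ℝ) : Prop :=
  ∃ (N : ℕ) (a : Fin N → X → ℝ), Neurons ξ W L N a ∧ ∀ j, A j ∈ affSpan a

namespace Computes

variable {X J J₁ J₂ : Type*} {d W L : ℕ} {ξ : Fin d → X → ℝ} {A : J → X → ℝ}

lemma input : Computes ξ W 0 ξ := ⟨d, ξ, .input, mem_affSpan⟩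

lemma of_mem (h : Computes ξ W L A) {A' : J₁ → X → ℝ} (hA : ∀ j, A' j ∈ affSpan A) :
    Computes ξ W L A' := by
  obtain ⟨N, a, ha, hAa⟩ := h
  exact ⟨N, a, ha, fun j => affSpan_le hAa (hA j)⟩

lemma exists_network (h : Computes ξ W L A) (j : J) :
    ∃ g ∈ NN d 1 W L, ∀ x, g (fun i => ξ i x) 0 = A j x := by
  obtain ⟨N, a, ha, hAa⟩ := h
  obtain ⟨m, c, hm⟩ := exists_coeff_of_mem_affSpan (hAa j)
  obtain ⟨g, hg, hgx⟩ := ha.exists_network (k := 1) (L' := 0)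
    (f := fun y _ => (∑ i, m i * y i) + c) ⟨fun _ => m, fun _ => c, fun _ _ => rfl⟩
  exact ⟨g, hg, fun x => by rw [hgx, hm]⟩

variable [Fintype J₁] [Fintype J₂]

lemma layer (h : Computes ξ W L A) {B : J₁ → X → ℝ} {T : J₂ → X → ℝ}
    (hB : ∀ j, B j ∈ affSpan A) (hT : ∀ j, T j ∈ affSpan A)
    (hW : 2 * Fintype.card J₁ + Fintype.card J₂ + 1 ≤ W) :
    Computes ξ W (L + 1) (Sum.elim B fun j x => relu (T j x)) := by
  obtain ⟨N, a, ha, hAa⟩ := h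
  let K := (J₁ ⊕ J₁) ⊕ J₂ ⊕ Unit
  let T' : K → X → ℝ := Sum.elim (Sum.elim B fun j x => - B j x) (Sum.elim T fun _ _ => 0)
  have hT' : ∀ k, T' k ∈ affSpan a := by
    have hle := affSpan_le hAa
    rintro ((j | j) | j | j)
    · exact hle (hB j)
    · exact hle (neg_mem_affSpan (hB j))
    · exact hle (hT j)
    · exact const_mem_affSpan 0
  have hcard : Fintype.card K = 2 * Fintype.card J₁ + Fintype.card J₂ + 1 := by
    simp [K]; ring
  let e := (Fintype.equivFin K).symm
  refine ⟨Fintype.card K, _, ha.layer (T := fun j => T' (e j)) (by omega) (by omega)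
    (fun j => hT' _), ?_⟩
  have key : ∀ k, (fun x => relu (T' k x)) ∈
      affSpan (fun (j : Fin (Fintype.card K)) x => relu (T' (e j) x)) := by
    intro k
    convert mem_affSpan (A := fun (j : Fin (Fintype.card K)) x => relu (T' (e j) x)) (e.symm k)
      using 1
    simp
  rintro (j | j)
  · have := sub_mem_affSpan (key (.inl (.inl j))) (key (.inl (.inr j)))
    convert this using 1
    ext x
    simp only [T', Sum.elim_inl, Sum.elim_inr, relu]
    rcases le_total (B j x) 0 with hx | hx <;> simp [hx]
  · exact key (.inr (.inl j))

/-- One hidden layer computes the indicator of a condition that is decided with a unit gap by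
the sign of a computed function. -/
lemma indicator (h : Computes ξ W L A) {B : J₁ → X → ℝ} {φ : J₂ → X → ℝ}
    (e : J₂ → X → Prop) [∀ j x, Decidable (e j x)]
    (hB : ∀ j, B j ∈ affSpan A) (hφ : ∀ j, φ j ∈ affSpan A)
    (hpos : ∀ j x, e j x → 0 ≤ φ j x) (hneg : ∀ j x, ¬ e j x → φ j x ≤ -1)
    (hW : 2 * Fintype.card J₁ + 2 * Fintype.card J₂ + 1 ≤ W) :
    Computes ξ W (L + 1) (Sum.elim B fun j x => if e j x then 1 else 0) := by
  have := h.layer (B := B) (T := Sum.elim (fun j x => φ j x + 1) φ) hB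
    (by rintro (j | j)
        · exact add_mem_affSpan (hφ j) (const_mem_affSpan 1)
        · exact hφ j) (by simp; omega)
  refine this.of_mem ?_
  rintro (j | j)
  · exact mem_affSpan (Sum.inl j)
  · convert sub_mem_affSpan (mem_affSpan (Sum.inr (Sum.inl j))) (mem_affSpan (Sum.inr (Sum.inr j)))
      using 1
    ext x
    simp only [Sum.elim_inr, Sum.elim_inl, relu]
    split_ifs with hx
    · have := hpos j x hx
      rw [max_eq_left (by linarith), max_eq_left this]; ring
    · have := hneg j x hx
      rw [max_eq_right (by linarith), max_eq_right (by linarith)]; ring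

/-- One hidden layer multiplies bounded computed functions by indicators. -/
lemma gate (h : Computes ξ W L A) {B : J₁ → X → ℝ} {y φ : J₂ → X → ℝ}
    (e : J₂ → X → Prop) [∀ j x, Decidable (e j x)]
    (hB : ∀ j, B j ∈ affSpan A) (hy : ∀ j, y j ∈ affSpan A) (hφ : ∀ j, φ j ∈ affSpan A)
    (hbdd : ∀ j, ∃ R, ∀ x, |y j x| ≤ R)
    (hpos : ∀ j x, e j x → φ j x = 0) (hneg : ∀ j x, ¬ e j x → φ j x ≤ -1)
    (hW : 2 * Fintype.card J₁ + 2 * Fintype.card J₂ + 1 ≤ W) :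
    Computes ξ W (L + 1) (Sum.elim B fun j x => if e j x then y j x else 0) := by
  choose R hR using hbdd
  have := h.layer (B := B) (T := Sum.elim (fun j x => y j x + R j * φ j x)
    (fun j x => - y j x + R j * φ j x)) hB
    (by rintro (j | j)
        · exact add_mem_affSpan (hy j) (mul_mem_affSpan _ (hφ j))
        · exact add_mem_affSpan (neg_mem_affSpan (hy j)) (mul_mem_affSpan _ (hφ j)))
    (by simp; omega)
  refine this.of_mem ?_
  rintro (j | j)
  · exact mem_affSpan (Sum.inl j)
  · convert sub_mem_affSpan (mem_affSpan (Sum.inr (Sum.inl j))) (mem_affSpan (Sum.inr (Sum.inr j)))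
      using 1
    ext x
    simp only [Sum.elim_inr, Sum.elim_inl, relu]
    split_ifs with hx
    · rw [hpos j x hx]
      rcases le_total (y j x) 0 with hx | hx <;> simp [hx]
    · have h1 := hneg j x hx
      have h2 := abs_le.1 (hR j x)
      have h3 : R j * φ j x ≤ - R j := by
        nlinarith [abs_nonneg (y j x), hR j x]
      rw [max_eq_right (by linarith), max_eq_right (by linarith)]; ring

end Computes

lemma sum_range_sub_mul_ite {g : ℕ → ℝ} {c M : ℕ} (h : c ≤ M) :
    ∑ i ∈ range M, (g (i + 1) - g i) * (if i + 1 ≤ c then 1 else 0) = g c - g 0 := by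
  rw [← sum_range_sub g c, ← sum_subset (range_subset_range.2 h)]
  · refine sum_congr rfl fun i hi => ?_
    rw [if_pos (by simpa using hi), mul_one]
  · intro i _ hi
    rw [if_neg (by simpa using hi), mul_zero]

/-- Interprets the last `Δ` base-`b` digits of `n` as digits in base `b ^ d`. -/
def spread (b d : ℕ) : ℕ → ℕ → ℕ
  | 0, _ => 0
  | Δ + 1, n => b ^ d * spread b d Δ (n / b) + n % b

/-- The Morton (Z-order) index of a grid point, obtained by interleaving the base-`b` digits of
its coordinates. -/
def morton (b d ℓ : ℕ) (n : Fin d → ℕ) : ℕ := ∑ j, spread b d ℓ (n j) * b ^ (j : ℕ)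

lemma spread_add {b d : ℕ} (hb : 0 < b) (ρ Δ n c : ℕ) (hc : c < b ^ Δ) :
    spread b d (ρ + Δ) (n * b ^ Δ + c) = (b ^ d) ^ Δ * spread b d ρ n + spread b d Δ c := by
  induction Δ generalizing c with
  | zero => simp_all [spread]
  | succ Δ ih =>
    have h1 : (n * b ^ (Δ + 1) + c) / b = n * b ^ Δ + c / b := by
      rw [pow_succ, ← mul_assoc, add_comm, Nat.add_mul_div_right _ _ hb, add_comm]
    have h2 : (n * b ^ (Δ + 1) + c) % b = c % b := by
      rw [pow_succ, ← mul_assoc, add_comm, Nat.add_mul_mod_self_right]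
    rw [← add_assoc, spread, h1, h2, ih _ (Nat.div_lt_of_lt_mul (by rwa [← pow_succ'])), spread]
    ring

/-- The grid coordinates of a point at resolution `b ^ (-ℓ)`. -/
def gridPoint (b ℓ : ℕ) {d : ℕ} (x : Fin d → ℝ) : Fin d → ℕ := fun j => ⌊(b : ℝ) ^ ℓ * x j⌋₊

lemma gridPoint_div (b ρ Δ : ℕ) (hb : 0 < b) {d : ℕ} (x : Fin d → ℝ) (j : Fin d) :
    gridPoint b (ρ + Δ) x j / b ^ Δ = gridPoint b ρ x j := by
  rw [gridPoint, ← Nat.floor_div_natCast, gridPoint]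
  congr 1
  have : (b : ℝ) ^ Δ ≠ 0 := by positivity
  push_cast
  rw [pow_add]
  field_simp

/-- The coordinates of a point, its grid coordinates, and the Morton index of its cell at
level `ρ`. -/
def mortonFamily {X : Type*} {d : ℕ} (b : ℕ) (ξ : Fin d → X → ℝ) (ρ : ℕ) :
    (Fin d ⊕ Fin d) ⊕ Unit → X → ℝ :=
  Sum.elim (Sum.elim ξ fun j x => (gridPoint b ρ (fun i => ξ i x) j : ℝ))
    fun _ x => (morton b d ρ (gridPoint b ρ fun i => ξ i x) : ℝ)

/-- At levels up to `ℓ`, the coordinates stay at distance `ε` to the left of the grid lines. -/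
structure GoodCoordinates {X : Type*} {d : ℕ} (b ℓ : ℕ) (ε : ℝ) (ξ : Fin d → X → ℝ) : Prop where
  nonneg : ∀ j x, 0 ≤ ξ j x
  lt_one : ∀ j x, ξ j x < 1
  gap : ∀ j x ρ m, ρ ≤ ℓ → m < b ^ ρ → ξ j x < m / (b : ℝ) ^ ρ → ξ j x + ε ≤ m / (b : ℝ) ^ ρ

lemma Computes.morton_step {X : Type*} {d b ℓ W L ρ Δ : ℕ} {ε : ℝ} {ξ : Fin d → X → ℝ}
    (hξ : GoodCoordinates b ℓ ε ξ) (hb : 0 < b) (hε : 0 < ε) (hρ : ρ + Δ ≤ ℓ)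
    (hW : 4 * d + 3 + 2 * d * b ^ Δ ≤ W) (h : Computes ξ W L (mortonFamily b ξ ρ)) :
    Computes ξ W (L + 1) (mortonFamily b ξ (ρ + Δ)) := by
  let p : X → Fin d → ℝ := fun x i => ξ i x
  let c : Fin d → X → ℕ := fun j x => gridPoint b (ρ + Δ) (p x) j % b ^ Δ
  have hbΔ : 0 < b ^ Δ := by positivity
  have hbρ : (0 : ℝ) < (b : ℝ) ^ (ρ + Δ) := by positivity
  have hc : ∀ j x, gridPoint b (ρ + Δ) (p x) j = gridPoint b ρ (p x) j * b ^ Δ + c j x := by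
    intro j x
    rw [← gridPoint_div b ρ Δ hb, mul_comm, Nat.div_add_mod]
  have hcb : ∀ j x, c j x < b ^ Δ := fun j x => Nat.mod_lt _ hbΔ
  have hlt : ∀ j x, gridPoint b ρ (p x) j < b ^ ρ := by
    intro j x
    have hb0 : (0 : ℝ) < (b : ℝ) ^ ρ := by positivity
    rw [gridPoint, Nat.floor_lt (mul_nonneg hb0.le (hξ.nonneg j x))]
    push_cast
    nlinarith [hξ.lt_one j x]
  have := h.indicator (J₂ := Fin d × Fin (b ^ Δ - 1)) (B := mortonFamily b ξ ρ)
    (φ := fun ji x => ε⁻¹ * (ξ ji.1 x - ((b : ℝ) ^ (ρ + Δ))⁻¹ *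
      ((b : ℝ) ^ Δ * gridPoint b ρ (p x) ji.1 + (ji.2 + 1))))
    (fun ji x => (ji.2 : ℕ) + 1 ≤ c ji.1 x) mem_affSpan ?_ ?_ ?_ ?_
  · refine this.of_mem ?_
    set A := Sum.elim (mortonFamily b ξ ρ)
      (fun (ji : Fin d × Fin (b ^ Δ - 1)) x => if (ji.2 : ℕ) + 1 ≤ c ji.1 x then (1 : ℝ) else 0)
    have hmem : ∀ j (g : ℕ → ℝ), (fun x => g (c j x)) ∈ affSpan A := by
      intro j g
      have h1 : (fun x => (∑ i ∈ range (b ^ Δ - 1), (g (i + 1) - g i) *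
          (if i + 1 ≤ c j x then 1 else 0)) + g 0) ∈ affSpan A := by
        refine add_mem_affSpan (sum_mem_affSpan _ fun i hi => mul_mem_affSpan _ ?_)
          (const_mem_affSpan _)
        exact mem_affSpan (A := A) (.inr (j, ⟨i, by simpa using hi⟩))
      convert h1 using 2 with x
      rw [sum_range_sub_mul_ite (by have := hcb j x; omega)]
      ring
    rintro ((j | j) | j)
    · exact mem_affSpan (A := A) (.inl (.inl (.inl j)))
    · have h1 : (fun x => (b : ℝ) ^ Δ * (gridPoint b ρ (p x) j : ℝ) + (c j x : ℝ)) ∈ affSpan A :=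
        add_mem_affSpan (mul_mem_affSpan _ (mem_affSpan (A := A) (.inl (.inl (.inr j)))))
          (hmem j fun n => n)
      convert h1 using 2 with x
      simp only [mortonFamily, Sum.elim_inl, Sum.elim_inr]
      rw [hc]
      push_cast
      ring
    · have h1 : (fun x => ((b : ℝ) ^ d) ^ Δ * (morton b d ρ (gridPoint b ρ (p x)) : ℝ) +
          ∑ j : Fin d, (b : ℝ) ^ (j : ℕ) * (spread b d Δ (c j x) : ℝ)) ∈ affSpan A :=
        add_mem_affSpan (mul_mem_affSpan _ (mem_affSpan (A := A) (.inl (.inr ()))))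
          (sum_mem_affSpan _ fun j _ => mul_mem_affSpan _ (hmem j fun n => spread b d Δ n))
      convert h1 using 2 with x
      simp only [mortonFamily, Sum.elim_inr]
      simp only [morton, hc, spread_add hb ρ Δ _ _ (hcb _ x), add_mul, sum_add_distrib, p]
      push_cast
      rw [mul_sum]
      congr 1
      · exact sum_congr rfl fun j _ => by ring
      · exact sum_congr rfl fun j _ => by ring
  · rintro ⟨j, i⟩
    refine mul_mem_affSpan _ (sub_mem_affSpan ?_ (mul_mem_affSpan _ (add_mem_affSpan
      (mul_mem_affSpan _ ?_) (const_mem_affSpan _))))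
    · exact mem_affSpan (A := mortonFamily b ξ ρ) (.inl (.inl j))
    · exact mem_affSpan (A := mortonFamily b ξ ρ) (.inl (.inr j))
  · rintro ⟨j, i⟩ x hi
    refine mul_nonneg (inv_nonneg.2 hε.le) (sub_nonneg.2 ?_)
    rw [inv_mul_le_iff₀ hbρ]
    have h1 : ((gridPoint b (ρ + Δ) (p x) j : ℕ) : ℝ) ≤ (b : ℝ) ^ (ρ + Δ) * ξ j x :=
      Nat.floor_le (mul_nonneg hbρ.le (hξ.nonneg j x))
    rw [hc] at h1
    push_cast at h1
    have h2 : ((i : ℕ) : ℝ) + 1 ≤ c j x := by exact_mod_cast hi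
    dsimp only at h2 ⊢
    linarith
  · rintro ⟨j, i⟩ x hi
    have h1 : (b : ℝ) ^ (ρ + Δ) * ξ j x < (gridPoint b (ρ + Δ) (p x) j : ℕ) + 1 :=
      Nat.lt_floor_add_one _
    rw [hc] at h1
    push_cast at h1
    have h2 : (c j x : ℝ) ≤ (i : ℕ) := by exact_mod_cast Nat.lt_succ_iff.1 (not_le.1 hi)
    have h3 := hξ.gap j x (ρ + Δ) (gridPoint b ρ (p x) j * b ^ Δ + (i + 1)) hρ ?_ ?_
    · push_cast at h3
      have : ξ j x - ((b : ℝ) ^ (ρ + Δ))⁻¹ *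
          ((b : ℝ) ^ Δ * gridPoint b ρ (p x) j + ((i : ℕ) + 1)) ≤ - ε := by
        rw [div_eq_inv_mul] at h3
        linarith
      dsimp only
      rw [inv_mul_le_iff₀ hε]
      linarith
    · have := hlt j x
      have hi' := i.2
      calc gridPoint b ρ (p x) j * b ^ Δ + (i + 1) < gridPoint b ρ (p x) j * b ^ Δ + b ^ Δ := by
            omega
        _ = (gridPoint b ρ (p x) j + 1) * b ^ Δ := by ring
        _ ≤ b ^ ρ * b ^ Δ := Nat.mul_le_mul_right _ this
        _ = _ := by ring
    · rw [lt_div_iff₀ hbρ]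
      push_cast
      linarith
  · simp only [Fintype.card_sum, Fintype.card_fin, Fintype.card_unit, Fintype.card_prod]
    have : d * (b ^ Δ - 1) ≤ d * b ^ Δ := Nat.mul_le_mul_left _ (Nat.sub_le _ _)
    rw [mul_assoc] at hW
    omega

lemma Computes.morton {X : Type*} {d b ℓ W α r : ℕ} {ε : ℝ} {ξ : Fin d → X → ℝ}
    (hξ : GoodCoordinates b ℓ ε ξ) (hb : 0 < b) (hε : 0 < ε)
    (hW : 4 * d + 3 + 2 * d * b ^ α ≤ W) (hr : ℓ ≤ r * α) :
    Computes ξ W r fun (_ : Unit) x => (morton b d ℓ (gridPoint b ℓ fun i => ξ i x) : ℝ) := by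
  have key : ∀ r, Computes ξ W r (mortonFamily b ξ (min (r * α) ℓ)) := by
    intro r
    induction r with
    | zero =>
      refine Computes.input.of_mem ?_
      rintro ((j | j) | j)
      · exact mem_affSpan j
      · convert const_mem_affSpan (A := ξ) 0 using 2 with x
        simp [mortonFamily, gridPoint, hξ.lt_one j x]
      · convert const_mem_affSpan (A := ξ) 0 using 2 with x
        simp [mortonFamily, _root_.morton, spread]
    | succ r ih =>
      have hle : min (r * α) ℓ ≤ min ((r + 1) * α) ℓ :=
        min_le_min_right _ (Nat.mul_le_mul_right _ (Nat.le_succ r))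
      have hΔ : min ((r + 1) * α) ℓ - min (r * α) ℓ ≤ α := by
        rw [add_mul]; omega
      have := ih.morton_step (Δ := min ((r + 1) * α) ℓ - min (r * α) ℓ) hξ hb hε
        (by omega) ((Nat.add_le_add_left (Nat.mul_le_mul_left _
          (Nat.pow_le_pow_right hb hΔ)) _).trans hW)
      rwa [Nat.add_sub_cancel' hle] at this
  have := key r
  rw [min_eq_right hr] at this
  exact this.of_mem fun _ => mem_affSpan (A := mortonFamily b ξ ℓ) (.inr ())

lemma sum_range_mul_eq {R : Type*} [AddCommMonoid R] (f : ℕ → R) (n M : ℕ) :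
    ∑ c ∈ range (n * M), f c = ∑ i ∈ range n, ∑ j ∈ range M, f (i * M + j) := by
  induction n with
  | zero => simp
  | succ n ih => rw [add_mul, one_mul, sum_range_add, ih, sum_range_succ]

/-- Three hidden layers of width proportional to `M` evaluate a step function with `M * M` jumps. -/
lemma Computes.lookup_block {X J : Type*} [Fintype J] {d W L M : ℕ} {ξ : Fin d → X → ℝ}
    {A : J → X → ℝ} (h : Computes ξ W L A) {u : X → ℕ} (hu : (fun x => (u x : ℝ)) ∈ affSpan A)
    {t : ℕ → ℕ} (ht : Monotone t) (w : ℕ → ℝ) (hM : 0 < M)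
    (hW : 2 * Fintype.card J + 4 * M + 3 ≤ W) :
    Computes ξ W (L + 3) (Sum.elim A fun (_ : Unit) x =>
      ∑ c ∈ range (M * M), w c * if t c ≤ u x then 1 else 0) := by
  let g : X → ℕ := fun x => Nat.findGreatest (fun i => t (i * M) ≤ u x) (M - 1)
  have hgM : ∀ x, g x < M := fun x => (Nat.findGreatest_le _).trans_lt (by omega)
  have hg : ∀ x i, i < M - 1 → (t ((i + 1) * M) ≤ u x ↔ i + 1 ≤ g x) := by
    intro x i hi
    refine ⟨fun h => Nat.le_findGreatest (by omega) h, fun h => ?_⟩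
    have := Nat.findGreatest_of_ne_zero (P := fun i => t (i * M) ≤ u x) (n := M - 1)
      (m := g x) rfl (by omega)
    exact (ht (Nat.mul_le_mul_right _ h)).trans this
  let P : ℕ → ℝ := fun n => ∑ i ∈ range n, ∑ j ∈ range M, w (i * M + j)
  have h1 := h.indicator (J₂ := Fin (M - 1)) (B := A)
    (φ := fun i x => (u x : ℝ) - t ((i + 1) * M)) (fun i x => t (((i : ℕ) + 1) * M) ≤ u x)
    mem_affSpan (fun i => sub_mem_affSpan hu (const_mem_affSpan _))
    (fun i x hi => sub_nonneg.2 (by exact_mod_cast hi))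
    (fun i x hi => by
      have : (u x : ℝ) + 1 ≤ t (((i : ℕ) + 1) * M) := by exact_mod_cast not_le.1 hi
      linarith) (by simp; omega)
  set A₁ := Sum.elim A fun (i : Fin (M - 1)) x =>
    if t (((i : ℕ) + 1) * M) ≤ u x then (1 : ℝ) else 0
  have hA₁ : ∀ φ : ℕ → ℝ, (fun x => φ (g x)) ∈ affSpan A₁ := by
    intro φ
    have h1 : (fun x => (∑ i ∈ range (M - 1), (φ (i + 1) - φ i) *
        (if i + 1 ≤ g x then 1 else 0)) + φ 0) ∈ affSpan A₁ := by
      refine add_mem_affSpan (sum_mem_affSpan _ fun i hi => mul_mem_affSpan _ ?_)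
        (const_mem_affSpan _)
      rw [mem_range] at hi
      convert mem_affSpan (A := A₁) (.inr ⟨i, hi⟩) using 2 with x
      simp only [A₁, Sum.elim_inr, hg x i hi]
    convert h1 using 2 with x
    rw [sum_range_sub_mul_ite (by have := hgM x; omega)]
    ring
  have huA₁ : (fun x => (u x : ℝ)) ∈ affSpan A₁ :=
    affSpan_le (fun j => mem_affSpan (A := A₁) (.inl j)) hu
  have h2 := h1.indicator (J₁ := J ⊕ Unit ⊕ Fin M) (J₂ := Fin M)
    (B := Sum.elim A (Sum.elim (fun _ x => P (g x)) fun j x => w (g x * M + j)))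
    (φ := fun j x => (u x : ℝ) - t (g x * M + j)) (fun j x => t (g x * M + j) ≤ u x)
    (by rintro (j | j | j)
        · exact mem_affSpan (A := A₁) (.inl j)
        · exact hA₁ P
        · exact hA₁ fun n => w (n * M + j))
    (fun j => sub_mem_affSpan huA₁ (hA₁ fun n => t (n * M + j)))
    (fun i x hi => sub_nonneg.2 (by exact_mod_cast hi))
    (fun i x hi => by
      have : (u x : ℝ) + 1 ≤ t (g x * M + i) := by exact_mod_cast not_le.1 hi
      linarith) (by simp; omega)
  set A₂ := Sum.elim (Sum.elim A (Sum.elim (fun (_ : Unit) x => P (g x))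
    fun (j : Fin M) x => w (g x * M + j)))
    fun (j : Fin M) x => if t (g x * M + j) ≤ u x then (1 : ℝ) else 0
  have h3 := h2.gate (J₁ := J ⊕ Unit) (J₂ := Fin M)
    (B := Sum.elim A fun _ x => P (g x)) (y := fun j x => w (g x * M + j))
    (φ := fun j x => (if t (g x * M + j) ≤ u x then (1 : ℝ) else 0) - 1)
    (fun j x => t (g x * M + j) ≤ u x)
    (by rintro (j | j)
        · exact mem_affSpan (A := A₂) (.inl (.inl j))
        · exact mem_affSpan (A := A₂) (.inl (.inr (.inl j))))
    (fun j => mem_affSpan (A := A₂) (.inl (.inr (.inr j))))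
    (fun j => sub_mem_affSpan (mem_affSpan (A := A₂) (.inr j)) (const_mem_affSpan _))
    (fun j => ⟨∑ c ∈ range (M * M), |w c|, fun x => by
      refine single_le_sum (f := fun c => |w c|) (fun _ _ => abs_nonneg _) (mem_range.2 ?_)
      nlinarith [hgM x, j.2]⟩)
    (fun j x hj => by simp [hj]) (fun j x hj => by simp [hj]) (by simp; omega)
  refine h3.of_mem ?_
  rintro (j | j)
  · exact mem_affSpan (Sum.inl (Sum.inl j))
  · have hP := add_mem_affSpan (mem_affSpan (A := Sum.elim (Sum.elim A fun (_ : Unit) x => P (g x))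
      fun (j : Fin M) x => if t (g x * M + j) ≤ u x then w (g x * M + j) else 0) (.inl (.inr ())))
      (sum_mem_affSpan univ fun j _ => mem_affSpan (Sum.inr j))
    convert hP using 2 with x
    simp only [Sum.elim_inr, Sum.elim_inl]
    rw [Fin.sum_univ_eq_sum_range (fun j => if t (g x * M + j) ≤ u x then w (g x * M + j) else 0),
      sum_range_mul_eq, ← sum_range_add_sum_Ico _ (hgM x).le, sum_eq_sum_Ico_succ_bot (hgM x),
      ← add_assoc, sum_eq_zero (s := Ico (g x + 1) M), add_zero]
    · congr 1
      · refine sum_congr rfl fun i hi => sum_congr rfl fun j hj => ?_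
        rw [mem_range] at hi hj
        have hgx := hgM x
        rw [if_pos, mul_one]
        refine le_trans (ht ?_) ((hg x (g x - 1) (by omega)).2 (by omega))
        rw [Nat.sub_add_cancel (by omega)]
        calc i * M + j ≤ i * M + M := by omega
          _ = (i + 1) * M := by ring
          _ ≤ g x * M := Nat.mul_le_mul_right _ hi
      · exact sum_congr rfl fun j _ => by simp
    · intro i hi
      rw [mem_Ico] at hi
      refine sum_eq_zero fun j _ => ?_
      rw [if_neg, mul_zero]
      intro hle
      have := (hg x (i - 1) (by omega)).1
        (by rw [Nat.sub_add_cancel (by omega)]; exact (ht (by omega)).trans hle)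
      omega

/-- Hidden layers of width proportional to `M` evaluate a step function with `r * M ^ 2` jumps at
depth `3 * r`. -/
lemma Computes.lookup {X J : Type*} [Fintype J] {d W L M : ℕ} {ξ : Fin d → X → ℝ}
    {A : J → X → ℝ} (h : Computes ξ W L A) {u : X → ℕ} (hu : (fun x => (u x : ℝ)) ∈ affSpan A)
    {t : ℕ → ℕ} (ht : Monotone t) (w : ℕ → ℝ) (hM : 0 < M)
    (hW : 2 * Fintype.card J + 4 * M + 5 ≤ W) (r : ℕ) :
    Computes ξ W (L + 3 * r) (Sum.elim A fun (_ : Unit) x =>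
      ∑ c ∈ range (r * (M * M)), w c * if t c ≤ u x then 1 else 0) := by
  induction r with
  | zero =>
    refine h.of_mem ?_
    rintro (j | j)
    · exact mem_affSpan j
    · simpa using const_mem_affSpan 0
  | succ r ih =>
    set A' := Sum.elim A fun (_ : Unit) x =>
      ∑ c ∈ range (r * (M * M)), w c * if t c ≤ u x then (1 : ℝ) else 0
    have h' := ih.lookup_block (u := u) (affSpan_le (fun j => mem_affSpan (A := A') (.inl j)) hu)
      (t := fun c => t (r * (M * M) + c)) (fun a b hab => ht (by omega))
      (fun c => w (r * (M * M) + c)) hM (by simp; omega)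
    refine Computes.of_mem h' ?_
    rintro (j | j)
    · exact mem_affSpan (Sum.inl (Sum.inl j))
    · convert add_mem_affSpan (mem_affSpan (Sum.inl (Sum.inr ()))) (mem_affSpan (Sum.inr ()))
        using 2 with x
      simp only [Sum.elim_inl, Sum.elim_inr, A']
      rw [add_mul, one_mul, sum_range_add]

/-- Several step functions with common jumps are evaluated one after the other. -/
lemma Computes.lookup_family {X J : Type*} [Fintype J] {d W L M r n : ℕ} {ξ : Fin d → X → ℝ}
    {A : J → X → ℝ} (h : Computes ξ W L A) {u : X → ℕ} (hu : (fun x => (u x : ℝ)) ∈ affSpan A)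
    {t : ℕ → ℕ} (ht : Monotone t) (w : Fin n → ℕ → ℝ) (hM : 0 < M)
    (hW : 2 * (Fintype.card J + n) + 4 * M + 5 ≤ W) :
    Computes ξ W (L + n * (3 * r)) (Sum.elim A fun (k : Fin n) x =>
      ∑ c ∈ range (r * (M * M)), w k c * if t c ≤ u x then 1 else 0) := by
  induction n with
  | zero =>
    rw [zero_mul]
    refine h.of_mem ?_
    rintro (j | j)
    · exact mem_affSpan j
    · exact j.elim0
  | succ n ih =>
    have h1 := ih (fun k => w k.castSucc) (by omega)
    set A' := Sum.elim A fun (k : Fin n) x =>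
      ∑ c ∈ range (r * (M * M)), w k.castSucc c * if t c ≤ u x then (1 : ℝ) else 0
    have h2 := h1.lookup (affSpan_le (fun j => mem_affSpan (A := A') (.inl j)) hu) ht
      (w (Fin.last n)) hM (by simp; omega) r
    rw [add_assoc, ← Nat.succ_mul] at h2
    refine h2.of_mem ?_
    rintro (j | j)
    · exact mem_affSpan (Sum.inl (Sum.inl j))
    · induction j using Fin.lastCases with
      | last => exact mem_affSpan (Sum.inr ())
      | cast j => exact mem_affSpan (Sum.inl (Sum.inr j))

section Machine

variable {κ S : Type*}

/-- The state reached by executing the instructions `l` one after the other, where execution halts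
for good as soon as the clock exceeds `u`. -/
def runStop (step : κ → S → S) (clock : S → ℝ) (u : ℝ) (l : List κ) (x : S) : S :=
  l.foldl (fun x a => if clock x ≤ u then step a x else x) x

/-- The state reached by executing all the instructions `l` one after the other. -/
def runAll (step : κ → S → S) (l : List κ) (x : S) : S := l.foldl (fun x a => step a x) x

/-- The clock never runs backwards, provided that the invariant `inv` holds. -/
structure ClockMonotone (step : κ → S → S) (clock : S → ℝ) (inv : S → Prop) : Prop where
  inv_step : ∀ a x, inv x → inv (step a x)
  clock_step : ∀ a x, inv x → clock x ≤ clock (step a x)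

variable {step : κ → S → S} {clock : S → ℝ} {inv : S → Prop} {u : ℝ} {x : S}

lemma runStop_append (l l' : List κ) :
    runStop step clock u (l ++ l') x = runStop step clock u l' (runStop step clock u l x) :=
  List.foldl_append

lemma runAll_append (l l' : List κ) :
    runAll step (l ++ l') x = runAll step l' (runAll step l x) :=
  List.foldl_append

lemma runStop_of_lt (h : u < clock x) (l : List κ) : runStop step clock u l x = x := by
  induction l with
  | nil => rfl
  | cons a l ih => simpa [runStop, not_le.2 h] using ih

lemma ClockMonotone.inv_runAll (hm : ClockMonotone step clock inv) (hx : inv x) (l : List κ) :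
    inv (runAll step l x) := by
  induction l generalizing x with
  | nil => exact hx
  | cons a l ih => exact ih (hm.inv_step a x hx)

lemma ClockMonotone.clock_runAll (hm : ClockMonotone step clock inv) (hx : inv x) (l : List κ) :
    clock x ≤ clock (runAll step l x) := by
  induction l generalizing x with
  | nil => exact le_rfl
  | cons a l ih => exact (hm.clock_step a x hx).trans (ih (hm.inv_step a x hx))

lemma ClockMonotone.runStop_eq (hm : ClockMonotone step clock inv) (hx : inv x) (l : List κ)
    (h : clock (runAll step l x) ≤ u) : runStop step clock u l x = runAll step l x := by
  induction l generalizing x with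
  | nil => rfl
  | cons a l ih =>
    have hle : clock x ≤ u := (hm.clock_runAll hx (a :: l)).trans h
    rw [runStop, List.foldl_cons, if_pos hle]
    exact ih (hm.inv_step a x hx) h

lemma ClockMonotone.lt_clock_runStop (hm : ClockMonotone step clock inv) (hx : inv x) (l : List κ)
    (h : u < clock (runAll step l x)) : u < clock (runStop step clock u l x) := by
  induction l generalizing x with
  | nil => exact h
  | cons a l ih =>
    by_cases hle : clock x ≤ u
    · rw [runStop, List.foldl_cons, if_pos hle]
      exact ih (hm.inv_step a x hx) h
    · rwa [runStop_of_lt (not_le.1 hle), ← not_le]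

/-- To execute a long program up to time `u`, it is enough to execute one chunk of it, starting
from a precomputed state. -/
lemma ClockMonotone.runStop_chunk (hm : ClockMonotone step clock inv) (hx : inv x) (P : List κ)
    (m k c : ℕ) (hP : P.length ≤ m * k)
    (h0 : clock (runAll step (P.take (c * m)) x) ≤ u)
    (h1 : c + 1 < k → u < clock (runAll step (P.take ((c + 1) * m)) x)) :
    runStop step clock u P x =
      runStop step clock u ((P.drop (c * m)).take m) (runAll step (P.take (c * m)) x) := by
  have e1 : P.take ((c + 1) * m) = P.take (c * m) ++ (P.drop (c * m)).take m := by
    rw [add_mul, one_mul, List.take_add]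
  have e2 : P = P.take (c * m) ++ (P.drop (c * m)).take m ++ P.drop ((c + 1) * m) := by
    rw [← e1, List.take_append_drop]
  conv_lhs => rw [e2]
  rw [runStop_append, runStop_append, hm.runStop_eq hx _ h0]
  rcases Nat.lt_or_ge (c + 1) k with hck | hck
  · refine runStop_of_lt (hm.lt_clock_runStop (hm.inv_runAll hx _) _ ?_) _
    rw [← runAll_append, ← e1]
    exact h1 hck
  · rw [List.drop_of_length_le]
    · rfl
    · calc P.length ≤ m * k := hP
        _ ≤ (c + 1) * m := by rw [mul_comm]; exact Nat.mul_le_mul_right _ hck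

end Machine

section Network

variable {κ σ : Type*} [DecidableEq κ]

/-- The positions of the instruction `a` among the first `n` instructions of a program, as an
integer with binary digits. -/
def tokenCode (a : κ) : ℕ → List κ → ℕ
  | 0, _ => 0
  | _ + 1, [] => 0
  | n + 1, c :: l => (if c = a then 2 ^ n else 0) + tokenCode a n l

lemma tokenCode_nil (a : κ) (n : ℕ) : tokenCode a n [] = 0 := by cases n <;> rfl

lemma tokenCode_lt (a : κ) (n : ℕ) (l : List κ) : tokenCode a n l < 2 ^ n := by
  induction n generalizing l with
  | zero => simp [tokenCode]
  | succ n ih =>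
    cases l with
    | nil => simp [tokenCode]
    | cons c l =>
      have := ih l
      rw [tokenCode, pow_succ]
      split_ifs <;> omega

lemma tokenCode_tail (a : κ) (n : ℕ) (l : List κ) :
    tokenCode a (n + 1) l = (if l.head? = some a then 2 ^ n else 0) + tokenCode a n l.tail := by
  cases l with
  | nil => simp [tokenCode, tokenCode_nil]
  | cons c l => simp [tokenCode]

lemma le_tokenCode_iff (a : κ) (n : ℕ) (l : List κ) :
    2 ^ n ≤ tokenCode a (n + 1) l ↔ l.head? = some a := by
  have := tokenCode_lt a n l.tail
  rw [tokenCode_tail]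
  split_ifs with h <;> simp [h]
  omega

variable [Fintype κ] [Fintype σ]

/-- The linear instruction with increment matrix `G a`. -/
def linearStep (G : κ → σ → σ → ℝ) (a : κ) (x : σ → ℝ) : σ → ℝ :=
  fun i => x i + ∑ k, G a i k * x k

omit [DecidableEq κ] in
lemma exists_gap (N : ℕ) (T : ℕ → ℝ) :
    ∃ η : ℝ, 0 < η ∧ ∀ v < N, (v : ℝ) < T v → (v : ℝ) + η ≤ T v := by
  induction N with
  | zero => exact ⟨1, one_pos, fun v hv => absurd hv (Nat.not_lt_zero v)⟩
  | succ N ih =>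
    obtain ⟨η, hη, h⟩ := ih
    by_cases hN : (N : ℝ) < T N
    · refine ⟨min η (T N - N), lt_min hη (sub_pos.2 hN), fun v hv hvT => ?_⟩
      rcases Nat.lt_succ_iff_lt_or_eq.1 hv with hv | rfl
      · exact (add_le_add_right (min_le_left _ _) _).trans (h v hv hvT)
      · linarith [min_le_right η (T v - v)]
    · refine ⟨η, hη, fun v hv hvT => ?_⟩
      rcases Nat.lt_succ_iff_lt_or_eq.1 hv with hv | rfl
      · exact h v hv hvT
      · exact absurd hvT hN

/-- A program of length `n` can be executed by `3 * n` hidden layers of bounded width. -/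
lemma Computes.runStop {X : Type*} {d W L N : ℕ} {ξ : Fin d → X → ℝ} {u : X → ℕ}
    (hu : ∀ x, u x < N) (G : κ → σ → σ → ℝ) (i₀ : σ)
    (hW : 2 * (1 + Fintype.card σ + Fintype.card κ) + 2 * (Fintype.card κ * Fintype.card σ) +
      2 * Fintype.card κ + 3 ≤ W) (n : ℕ) (S : ℕ → σ → ℝ) (l : ℕ → List κ)
    (hl : ∀ v, (l v).length ≤ n)
    (h : Computes ξ W L (Sum.elim (fun (_ : Unit) x => (u x : ℝ))
      (Sum.elim (fun i x => S (u x) i) fun a x => (tokenCode a n (l (u x)) : ℝ)))) (i : σ) :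
    Computes ξ W (L + 3 * n) fun (_ : Unit) x =>
      runStop (linearStep G) (fun y => y i₀) (u x) (l (u x)) (S (u x)) i := by
  induction n generalizing L S l with
  | zero =>
    refine h.of_mem fun _ => ?_
    have h0 : ∀ v, l v = [] := fun v => List.length_eq_zero_iff.1 (Nat.le_zero.1 (hl v))
    simp only [h0]
    exact mem_affSpan (Sum.inr (Sum.inl i))
  | succ n ih =>
    obtain ⟨η, hη, hgap⟩ := exists_gap N fun v => S v i₀
    set A := (Sum.elim (fun (_ : Unit) x => (u x : ℝ))
      (Sum.elim (fun i x => S (u x) i) fun a x => (tokenCode a (n + 1) (l (u x)) : ℝ)))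
    have h1 := h.indicator (B := A) (φ := fun a x => (tokenCode a (n + 1) (l (u x)) : ℝ) - 2 ^ n)
      (fun a x => (l (u x)).head? = some a) mem_affSpan
      (fun a => sub_mem_affSpan (mem_affSpan (A := A) (.inr (.inr a))) (const_mem_affSpan _))
      (fun a x hx => by
        have := (le_tokenCode_iff a n _).2 hx
        rw [sub_nonneg]
        exact_mod_cast this)
      (fun a x hx => by
        have := mt (le_tokenCode_iff a n _).1 hx
        have h2 : (tokenCode a (n + 1) (l (u x)) : ℝ) + 1 ≤ 2 ^ n := by
          exact_mod_cast not_le.1 this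
        linarith)
      (by simp; omega)
    set A₁ := Sum.elim A fun a x => if (l (u x)).head? = some a then (1 : ℝ) else 0
    set B : Unit ⊕ σ ⊕ κ → X → ℝ := Sum.elim (fun _ x => (u x : ℝ))
      (Sum.elim (fun i x => S (u x) i) fun a x => (tokenCode a n (l (u x)).tail : ℝ)) with hB
    have h2 := h1.indicator (B := Sum.elim B fun a x => if (l (u x)).head? = some a then 1 else 0)
      (φ := fun (_ : Unit) x => η⁻¹ * ((u x : ℝ) - S (u x) i₀))
      (fun _ x => S (u x) i₀ ≤ u x)
      (by
        rintro ((_ | i | a) | a)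
        · exact mem_affSpan (A := A₁) (.inl (.inl ()))
        · exact mem_affSpan (A := A₁) (.inl (.inr (.inl i)))
        · have := sub_mem_affSpan (mem_affSpan (A := A₁) (.inl (.inr (.inr a))))
            (mul_mem_affSpan (2 ^ n) (mem_affSpan (A := A₁) (.inr a)))
          convert this using 2 with x
          simp only [hB, A₁, A, Sum.elim_inl, Sum.elim_inr, tokenCode_tail a n (l (u x))]
          push_cast
          split_ifs <;> ring
        · exact mem_affSpan (A := A₁) (.inr a))
      (fun _ => mul_mem_affSpan _ (sub_mem_affSpan (mem_affSpan (A := A₁) (.inl (.inl ())))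
        (mem_affSpan (A := A₁) (.inl (.inr (.inl i₀))))))
      (fun _ x hx => mul_nonneg (inv_nonneg.2 hη.le) (sub_nonneg.2 hx))
      (fun _ x hx => by
        have := hgap (u x) (hu x) (not_le.1 hx)
        rw [inv_mul_le_iff₀ hη]
        linarith)
      (by simp; omega)
    set A₂ := Sum.elim (Sum.elim B fun a x => if (l (u x)).head? = some a then (1 : ℝ) else 0)
      fun (_ : Unit) x => if S (u x) i₀ ≤ u x then (1 : ℝ) else 0 with hA₂
    have h3 := h2.gate (B := B) (J₂ := κ × σ) (y := fun j x => ∑ k, G j.1 j.2 k * S (u x) k)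
      (φ := fun j x => (if (l (u x)).head? = some j.1 then (1 : ℝ) else 0) +
        (if S (u x) i₀ ≤ u x then (1 : ℝ) else 0) - 2)
      (fun j x => (l (u x)).head? = some j.1 ∧ S (u x) i₀ ≤ u x)
      (fun j => mem_affSpan (A := A₂) (.inl (.inl j)))
      (fun j => sum_mem_affSpan _ fun k _ => mul_mem_affSpan _
        (mem_affSpan (A := A₂) (.inl (.inl (.inr (.inl k))))))
      (fun j => sub_mem_affSpan (add_mem_affSpan (mem_affSpan (A := A₂) (.inl (.inr j.1)))
        (mem_affSpan (A := A₂) (.inr ()))) (const_mem_affSpan _))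
      (fun j => ⟨∑ v ∈ range N, |∑ k, G j.1 j.2 k * S v k|, fun x =>
        single_le_sum (f := fun v => |∑ k, G j.1 j.2 k * S v k|) (fun _ _ => abs_nonneg _)
          (mem_range.2 (hu x))⟩)
      (fun j x hx => by rw [if_pos hx.1, if_pos hx.2]; norm_num)
      (fun j x hx => by
        rw [not_and_or] at hx
        rcases hx with hx | hx <;> rw [if_neg hx] <;> split_ifs <;> norm_num)
      (by simp; omega)
    set A₃ := Sum.elim B fun (j : κ × σ) x =>
      if (l (u x)).head? = some j.1 ∧ S (u x) i₀ ≤ u x then ∑ k, G j.1 j.2 k * S (u x) k else 0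
    let S' : ℕ → σ → ℝ := fun v =>
      (l v).head?.elim (S v) fun a => if S v i₀ ≤ v then linearStep G a (S v) else S v
    have h4 := ih S' (fun v => (l v).tail) (fun v => by
      rw [List.length_tail]; have := hl v; omega) (L := L + 3) (h3.of_mem (by
        rintro (_ | i | a)
        · exact mem_affSpan (A := A₃) (.inl (.inl ()))
        · have := add_mem_affSpan (mem_affSpan (A := A₃) (.inl (.inr (.inl i))))
            (sum_mem_affSpan univ fun a _ => mem_affSpan (A := A₃) (.inr (a, i)))
          convert this using 2 with x
          simp only [Sum.elim_inr, Sum.elim_inl, S', A₃, hB]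
          rcases (l (u x)).head? with _ | a
          · simp
          · by_cases hx : S (u x) i₀ ≤ u x
            · simp [hx, linearStep]
            · simp [hx]
        · exact mem_affSpan (A := A₃) (.inl (.inr (.inr a)))))
    rw [show L + 3 * (n + 1) = L + 3 + 3 * n by ring]
    convert h4 using 3 with _ x
    simp only [S']
    rcases l (u x) with _ | ⟨a, l⟩ <;> rfl

/-- A program of length `m * (r * M ^ 2)` can be executed by a ReLU network whose width is
proportional to `M` and whose depth is proportional to `r + m`. -/
lemma Computes.program {X : Type*} {d W L N m r M : ℕ} {ξ : Fin d → X → ℝ} {u : X → ℕ}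
    (hu : ∀ x, u x < N) (h : Computes ξ W L fun (_ : Unit) x => (u x : ℝ))
    (G : κ → σ → σ → ℝ) (i₀ : σ) {inv : (σ → ℝ) → Prop}
    (hm : ClockMonotone (linearStep G) (fun y => y i₀) inv) {x₀ : σ → ℝ} (hx₀ : inv x₀)
    (h0 : x₀ i₀ ≤ 0) (hr : 0 < r) (hM : 0 < M) (P : List κ) (hP : P.length ≤ m * (r * (M * M)))
    (hW : 2 * (1 + Fintype.card σ + Fintype.card κ) + 2 * (Fintype.card κ * Fintype.card σ) +
      2 * Fintype.card κ + 4 * M + 5 ≤ W) (i : σ) :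
    Computes ξ W (L + (Fintype.card σ + Fintype.card κ) * (3 * r) + 3 * m) fun (_ : Unit) x =>
      _root_.runStop (linearStep G) (fun y => y i₀) (u x) P x₀ i := by
  obtain ⟨k, hk⟩ : ∃ k, r * (M * M) = k + 1 := Nat.exists_eq_succ_of_ne_zero (by positivity)
  let Sc : ℕ → σ → ℝ := fun c => runAll (linearStep G) (P.take (c * m)) x₀
  let lc : ℕ → List κ := fun c => (P.drop (c * m)).take m
  let t : ℕ → ℕ := fun c => ⌈Sc c i₀⌉₊
  have ht0 : t 0 = 0 := by simpa [t, Sc, runAll] using h0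
  have ht : Monotone t := by
    refine monotone_nat_of_le_succ fun c => Nat.ceil_mono ?_
    simp only [Sc]
    rw [add_mul, one_mul, List.take_add, runAll_append]
    exact hm.clock_runAll (hm.inv_runAll hx₀ _) _
  let c : ℕ → ℕ := fun v => Nat.findGreatest (fun c => t c ≤ v) k
  have hck : ∀ v, c v ≤ k := fun v => Nat.findGreatest_le _
  have hc : ∀ v i, i < k → (t (i + 1) ≤ v ↔ i + 1 ≤ c v) := by
    intro v i hi
    refine ⟨fun h => Nat.le_findGreatest (by omega) h, fun h => ?_⟩
    exact (ht h).trans (Nat.findGreatest_of_ne_zero (P := fun c => t c ≤ v) (n := k) rfl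
      (by omega))
  let y : σ ⊕ κ → ℕ → ℝ := Sum.elim (fun i c => Sc c i) fun a c => (tokenCode a m (lc c) : ℝ)
  let e : Fin (Fintype.card (σ ⊕ κ)) ≃ σ ⊕ κ := (Fintype.equivFin _).symm
  have h1 := h.lookup_family (u := u) (r := r) (M := M) (mem_affSpan ()) ht
    (fun j c => y (e j) c - if c = 0 then 0 else y (e j) (c - 1)) hM
    (by simp only [Fintype.card_unit, Fintype.card_sum]; omega)
  have key : ∀ j v, ∑ c ∈ range (r * (M * M)),
      (y j c - if c = 0 then 0 else y j (c - 1)) * (if t c ≤ v then 1 else 0) = y j (c v) := by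
    intro j v
    rw [hk, sum_range_succ']
    simp only [ht0, Nat.zero_le, if_true, Nat.add_eq_zero_iff, one_ne_zero, and_false, if_false,
      Nat.add_sub_cancel]
    rw [sum_congr rfl fun i hi => by rw [if_congr (hc v i (mem_range.1 hi)) rfl rfl],
      sum_range_sub_mul_ite (hck v)]
    ring
  simp only [key] at h1
  rw [← Fintype.card_sum (α := σ) (β := κ)]
  have h2 := Computes.runStop hu G i₀ (by omega) m (fun v => Sc (c v)) (fun v => lc (c v))
    (fun v => by simp [lc]) (h1.of_mem (by
      have hj : ∀ j : σ ⊕ κ, (fun x => y j (c (u x))) ∈ affSpan (Sum.elim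
          (fun (_ : Unit) x => (u x : ℝ)) fun i x => y (e i) (c (u x))) := by
        intro j
        convert mem_affSpan (Sum.inr (e.symm j)) using 2
        simp
      rintro (_ | i | a)
      · exact mem_affSpan (Sum.inl ())
      · exact hj (.inl i)
      · exact hj (.inr a))) i
  convert h2 using 3 with _ x
  refine congrFun (hm.runStop_chunk hx₀ P m (r * (M * M)) _ hP ?_ ?_) i
  · rw [← Nat.ceil_le]
    rcases Nat.eq_zero_or_pos (c (u x)) with h | h
    · rw [h]; exact ht0.le.trans (Nat.zero_le _)
    · have := (hc (u x) (c (u x) - 1) (by have := hck (u x); omega)).2 (by omega)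
      rwa [Nat.sub_add_cancel h] at this
  · intro hlt
    rw [← Nat.lt_ceil, ← not_le]
    intro hle
    have := (hc (u x) (c (u x)) (by omega)).1 hle
    omega

end Network

section Traversal

/-- Increment matrices of a machine with state `![t, v, h, δ]` that traverses a `D`-ary tree. The
five instructions advance the clock `t` by `h`, increase and decrease the value `v` by `δ`, descend
to the next level of the tree, and ascend again. -/
def treeMatrix (D ρ : ℝ) : Fin 5 → Fin 4 → Fin 4 → ℝ :=
  ![![![0, 0, 1, 0], 0, 0, 0],
    ![0, ![0, 0, 0, 1], 0, 0],
    ![0, ![0, 0, 0, -1], 0, 0],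
    ![0, 0, ![0, 0, D⁻¹ - 1, 0], ![0, 0, 0, ρ - 1]],
    ![0, 0, ![0, 0, D - 1, 0], ![0, 0, 0, ρ⁻¹ - 1]]]

variable {D : ℕ} {ρ t v h δ : ℝ}

lemma linearStep_advance :
    linearStep (treeMatrix D ρ) 0 ![t, v, h, δ] = ![t + h, v, h, δ] := by
  ext i; fin_cases i <;> simp [linearStep, treeMatrix, Fin.sum_univ_four]

lemma linearStep_increase :
    linearStep (treeMatrix D ρ) 1 ![t, v, h, δ] = ![t, v + δ, h, δ] := by
  ext i; fin_cases i <;> simp [linearStep, treeMatrix, Fin.sum_univ_four]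

lemma linearStep_decrease :
    linearStep (treeMatrix D ρ) 2 ![t, v, h, δ] = ![t, v - δ, h, δ] := by
  ext i; fin_cases i <;> simp [linearStep, treeMatrix, Fin.sum_univ_four, sub_eq_add_neg]

lemma linearStep_descend :
    linearStep (treeMatrix D ρ) 3 ![t, v, h, δ] = ![t, v, h / D, δ * ρ] := by
  ext i; fin_cases i <;> simp [linearStep, treeMatrix, Fin.sum_univ_four] <;> ring

lemma linearStep_ascend :
    linearStep (treeMatrix D ρ) 4 ![t, v, h, δ] = ![t, v, h * D, δ / ρ] := by
  ext i; fin_cases i <;> simp [linearStep, treeMatrix, Fin.sum_univ_four] <;> ring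

lemma treeMatrix_clockMonotone :
    ClockMonotone (linearStep (treeMatrix D ρ)) (fun x => x 0) fun x => 0 ≤ x 2 := by
  have hx : ∀ x : Fin 4 → ℝ, x = ![x 0, x 1, x 2, x 3] := fun x => by
    ext i; fin_cases i <;> rfl
  constructor <;> intro a x h <;> rw [hx x] <;> fin_cases a <;>
    simp [linearStep_advance, linearStep_increase, linearStep_decrease, linearStep_descend,
      linearStep_ascend, h] <;> positivity

/-- Instructions adding `z * δ` to the value. -/
def addProgram (z : ℤ) : List (Fin 5) := List.replicate z.natAbs (if 0 ≤ z then 1 else 2)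

lemma length_addProgram (z : ℤ) : (addProgram z).length = z.natAbs := List.length_replicate

lemma runAll_addProgram (z : ℤ) : runAll (linearStep (treeMatrix D ρ)) (addProgram z)
    ![t, v, h, δ] = ![t, v + z * δ, h, δ] := by
  have h1 : ∀ n : ℕ, ∀ v, runAll (linearStep (treeMatrix D ρ)) (List.replicate n 1)
      ![t, v, h, δ] = ![t, v + n * δ, h, δ] := by
    intro n
    induction n with
    | zero => intro v; simp [runAll]
    | succ n ih =>
      intro v
      have := ih (v + δ)
      rw [runAll] at this ⊢
      rw [List.replicate_succ, List.foldl_cons, linearStep_increase, this]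
      push_cast
      ring_nf
  have h2 : ∀ n : ℕ, ∀ v, runAll (linearStep (treeMatrix D ρ)) (List.replicate n 2)
      ![t, v, h, δ] = ![t, v - n * δ, h, δ] := by
    intro n
    induction n with
    | zero => intro v; simp [runAll]
    | succ n ih =>
      intro v
      have := ih (v - δ)
      rw [runAll] at this ⊢
      rw [List.replicate_succ, List.foldl_cons, linearStep_decrease, this]
      push_cast
      ring_nf
  rw [addProgram]
  split_ifs with hz
  · rw [h1, Nat.cast_natAbs, abs_of_nonneg hz]
  · rw [h2, Nat.cast_natAbs, abs_of_neg (not_le.1 hz)]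
    push_cast
    ring_nf

/-- The total mass of the coefficients `y` below the node `u` of height `r`. -/
def treeMass (D : ℕ) (y : ℕ → ℕ → ℤ) : ℕ → ℕ → ℕ
  | 0, _ => 0
  | r + 1, u => ∑ c ∈ range D, ((y r (u * D + c)).natAbs + treeMass D y r (u * D + c))

/-- A program visiting all nodes below the node `u` of height `r` at which coefficients are
nonzero. -/
def treeProgram (D : ℕ) (y : ℕ → ℕ → ℤ) : ℕ → ℕ → List (Fin 5)
  | 0, _ => [0]
  | r + 1, u => if treeMass D y (r + 1) u = 0 then [0] else
      [3] ++ (List.range D).flatMap (fun c => addProgram (y r (u * D + c)) ++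
        treeProgram D y r (u * D + c) ++ addProgram (- y r (u * D + c))) ++ [4]

variable {y : ℕ → ℕ → ℤ}

lemma runAll_flatMap_range {F : ℕ → List (Fin 5)} {w : ℕ → ℝ} {h : ℝ}
    (hF : ∀ c t v, runAll (linearStep (treeMatrix D ρ)) (F c) ![t, v, h, δ] =
      ![t + h, v + w c, h, δ]) (n : ℕ) :
    runAll (linearStep (treeMatrix D ρ)) ((List.range n).flatMap F) ![t, v, h, δ] =
      ![t + n * h, v + ∑ c ∈ range n, w c, h, δ] := by
  induction n with
  | zero => simp [runAll]
  | succ n ih =>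
    rw [List.range_succ, List.flatMap_append, runAll_append, ih, List.flatMap_singleton, hF,
      sum_range_succ]
    push_cast
    ring_nf

lemma runAll_treeProgram (hD : D ≠ 0) (hρ : ρ ≠ 0) (r u : ℕ) (t v h δ : ℝ) :
    runAll (linearStep (treeMatrix D ρ)) (treeProgram D y r u) ![t, v, h, δ] =
      ![t + h, v, h, δ] := by
  induction r generalizing u t v h δ with
  | zero => exact linearStep_advance
  | succ r ih =>
    rw [treeProgram]
    split_ifs
    · exact linearStep_advance
    · have h1 : ∀ t v h δ, runAll (linearStep (treeMatrix D ρ)) [3] ![t, v, h, δ] =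
        ![t, v, h / D, δ * ρ] := fun _ _ _ _ => linearStep_descend
      have h2 : ∀ t v h δ, runAll (linearStep (treeMatrix D ρ)) [4] ![t, v, h, δ] =
        ![t, v, h * D, δ / ρ] := fun _ _ _ _ => linearStep_ascend
      rw [runAll_append, runAll_append, h1, runAll_flatMap_range (w := fun _ => 0), h2]
      · have : (D : ℝ) ≠ 0 := by exact_mod_cast hD
        simp only [sum_const_zero, add_zero]
        field_simp
      · intro c t v
        rw [runAll_append, runAll_append, runAll_addProgram, ih, runAll_addProgram]
        push_cast
        ring_nf

lemma eq_zero_of_treeMass_eq_zero (hD : 0 < D) {r u w : ℕ} (h : treeMass D y r u = 0)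
    (hw : w / D ^ r = u) {k : ℕ} (hk : k < r) : y k (w / D ^ k) = 0 := by
  induction r generalizing u with
  | zero => omega
  | succ r ih =>
    have hu : w / D ^ r = u * D + w / D ^ r % D := by
      rw [← hw, pow_succ, ← Nat.div_div_eq_div_mul]
      exact (Nat.div_add_mod' _ _).symm
    rw [treeMass, sum_eq_zero_iff] at h
    have := h (w / D ^ r % D) (mem_range.2 (Nat.mod_lt _ hD))
    rw [← hu] at this
    rcases Nat.lt_succ_iff_lt_or_eq.1 hk with hk | rfl
    · exact ih (by omega) rfl hk
    · omega

lemma exists_range_eq_append {c D : ℕ} (hc : c < D) :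
    ∃ l, List.range D = List.range c ++ c :: l := by
  refine ⟨(List.range D).drop (c + 1), ?_⟩
  conv_lhs => rw [← List.take_append_drop c (List.range D)]
  rw [List.take_range, min_eq_left hc.le, List.drop_eq_getElem_cons (by simpa using hc),
    List.getElem_range]

lemma runStop_treeProgram (hD : 0 < D) (hρ : ρ ≠ 0) {r u w : ℕ} (hw : w / D ^ r = u) (v δ : ℝ) :
    (w : ℝ) < runStop (linearStep (treeMatrix D ρ)) (fun x => x 0) w (treeProgram D y r u)
      ![u * (D : ℝ) ^ r, v, (D : ℝ) ^ r, δ] 0 ∧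
    runStop (linearStep (treeMatrix D ρ)) (fun x => x 0) w (treeProgram D y r u)
      ![u * (D : ℝ) ^ r, v, (D : ℝ) ^ r, δ] 1 =
      v + ∑ k ∈ range r, δ * ρ ^ (r - k) * y k (w / D ^ k) := by
  have hle : ∀ r, ((w / D ^ r : ℕ) : ℝ) * (D : ℝ) ^ r ≤ w := fun r => by
    exact_mod_cast Nat.div_mul_le_self _ _
  have hlt : ∀ r, (w : ℝ) < (w / D ^ r : ℕ) * (D : ℝ) ^ r + (D : ℝ) ^ r := fun r => by
    exact_mod_cast Nat.lt_div_mul_add (by positivity)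
  have hadv : ∀ r v δ, runStop (linearStep (treeMatrix D ρ)) (fun x => x 0) w [0]
      ![(w / D ^ r : ℕ) * (D : ℝ) ^ r, v, (D : ℝ) ^ r, δ] =
      ![(w / D ^ r : ℕ) * (D : ℝ) ^ r + (D : ℝ) ^ r, v, (D : ℝ) ^ r, δ] := by
    intro r v δ
    rw [runStop, List.foldl_cons, if_pos (by simpa using hle r), linearStep_advance]
    rfl
  subst hw
  induction r generalizing v δ with
  | zero =>
    rw [treeProgram, hadv]
    exact ⟨hlt 0, by simp⟩
  | succ r ih =>
    rw [treeProgram]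
    split_ifs with hmass
    · rw [hadv]
      refine ⟨hlt _, ?_⟩
      rw [sum_eq_zero, add_zero]
      · rfl
      · intro k hk
        rw [eq_zero_of_treeMass_eq_zero hD hmass rfl (mem_range.1 hk), Int.cast_zero, mul_zero]
    · have hD' : (D : ℝ) ≠ 0 := by exact_mod_cast hD.ne'
      have hc : w / D ^ r % D < D := Nat.mod_lt _ hD
      have hu : w / D ^ (r + 1) * D + w / D ^ r % D = w / D ^ r := by
        rw [pow_succ, ← Nat.div_div_eq_div_mul]
        exact Nat.div_add_mod' _ _
      set c := w / D ^ r % D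
      set u := w / D ^ (r + 1)
      obtain ⟨l, hl⟩ := exists_range_eq_append hc
      have hm := treeMatrix_clockMonotone (D := D) (ρ := ρ)
      have hpos : ∀ t v δ, (0 : ℝ) ≤ (![t, v, (D : ℝ) ^ r, δ] : Fin 4 → ℝ) 2 := fun t v δ => by
        simp only [Matrix.cons_val]; positivity
      have huc : (u * (D : ℝ) ^ (r + 1) + c * (D : ℝ) ^ r) = (w / D ^ r : ℕ) * (D : ℝ) ^ r := by
        rw [← hu]; push_cast; ring
      have hblock : ∀ c t v, runAll (linearStep (treeMatrix D ρ)) (addProgram (y r (u * D + c)) ++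
          treeProgram D y r (u * D + c) ++ addProgram (- y r (u * D + c)))
          ![t, v, (D : ℝ) ^ r, δ * ρ] = ![t + (D : ℝ) ^ r, v + 0, (D : ℝ) ^ r, δ * ρ] := by
        intro c t v
        rw [runAll_append, runAll_append, runAll_addProgram, runAll_treeProgram hD.ne' hρ,
          runAll_addProgram]
        push_cast
        ring_nf
      have h1 : runStop (linearStep (treeMatrix D ρ)) (fun x => x 0) w [3]
          ![u * (D : ℝ) ^ (r + 1), v, (D : ℝ) ^ (r + 1), δ] =
          ![u * (D : ℝ) ^ (r + 1), v, (D : ℝ) ^ r, δ * ρ] := by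
        rw [runStop, List.foldl_cons, if_pos (by simpa using hle (r + 1)), linearStep_descend, pow_succ,
          mul_div_cancel_right₀ _ hD']
        rfl
      have h2 := runAll_flatMap_range (w := fun _ => 0) (t := u * (D : ℝ) ^ (r + 1)) (v := v)
        hblock c
      rw [huc, sum_const_zero, add_zero] at h2
      rw [hl, List.flatMap_append, List.flatMap_cons, runStop_append, runStop_append,
        runStop_append, runStop_append, runStop_append, runStop_append, h1,
        hm.runStop_eq (hpos _ _ _) ((List.range c).flatMap _) (by rw [h2]; exact hle r), h2,
        hm.runStop_eq (hpos _ _ _) (addProgram _) (by rw [runAll_addProgram]; exact hle r),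
        runAll_addProgram, hu]
      have h3 := ih (v + y r (w / D ^ r) * (δ * ρ)) (δ * ρ)
      have h4 := fun l : List (Fin 5) => runStop_of_lt (step := linearStep (treeMatrix D ρ))
        (clock := fun x => x 0) h3.1 l
      simp only [h4]
      refine ⟨h3.1, h3.2.trans ?_⟩
      have h5 : ∀ k ∈ range r, δ * ρ ^ (r + 1 - k) * y k (w / D ^ k) =
          δ * ρ * ρ ^ (r - k) * y k (w / D ^ k) := fun k hk => by
        rw [Nat.sub_add_comm (mem_range.1 hk).le, pow_succ', ← mul_assoc δ]
      rw [sum_range_succ, Nat.add_sub_cancel_left, pow_one, sum_congr rfl h5]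
      ring

/-- The traversal of a forest with `n` trees of height `r`, where the increment `z u` is added
permanently before visiting the `u`-th tree. -/
def forestProgram (D : ℕ) (y : ℕ → ℕ → ℤ) (z : ℕ → ℤ) (r n : ℕ) : List (Fin 5) :=
  (List.range n).flatMap fun u => addProgram (z u) ++ treeProgram D y r u

lemma runStop_forestProgram (hD : 0 < D) (hρ : ρ ≠ 0) {z : ℕ → ℤ} {r n w : ℕ} (hw : w < n * D ^ r)
    (δ : ℝ) :
    runStop (linearStep (treeMatrix D ρ)) (fun x => x 0) w (forestProgram D y z r n)
      ![0, 0, (D : ℝ) ^ r, δ] 1 = δ * ∑ u ∈ range (w / D ^ r + 1), (z u : ℝ) +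
        ∑ k ∈ range r, δ * ρ ^ (r - k) * y k (w / D ^ k) := by
  have hm := treeMatrix_clockMonotone (D := D) (ρ := ρ)
  have hpos : ∀ t v δ, (0 : ℝ) ≤ (![t, v, (D : ℝ) ^ r, δ] : Fin 4 → ℝ) 2 := fun t v δ => by
    simp only [Matrix.cons_val]; positivity
  have hle : ((w / D ^ r : ℕ) : ℝ) * (D : ℝ) ^ r ≤ w := by
    exact_mod_cast Nat.div_mul_le_self _ _
  obtain ⟨l, hl⟩ := exists_range_eq_append ((Nat.div_lt_iff_lt_mul (by positivity)).2 hw)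
  have h2 := runAll_flatMap_range (D := D) (ρ := ρ) (F := fun u => addProgram (z u) ++
    treeProgram D y r u) (w := fun u => z u * δ) (h := (D : ℝ) ^ r) (δ := δ) (t := 0) (v := 0)
    (fun c t v => by rw [runAll_append, runAll_addProgram, runAll_treeProgram hD.ne' hρ])
    (w / D ^ r)
  rw [zero_add, zero_add] at h2
  rw [forestProgram, hl, List.flatMap_append, List.flatMap_cons, runStop_append, runStop_append,
    runStop_append, hm.runStop_eq (hpos _ _ _) ((List.range _).flatMap _) (by rw [h2]; exact hle),
    h2, hm.runStop_eq (hpos _ _ _) (addProgram _) (by rw [runAll_addProgram]; exact hle),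
    runAll_addProgram]
  have h3 := runStop_treeProgram (y := y) hD hρ (r := r) (w := w) rfl
    ((∑ u ∈ range (w / D ^ r), z u * δ) + z (w / D ^ r) * δ) δ
  have h4 := fun l : List (Fin 5) => runStop_of_lt (step := linearStep (treeMatrix D ρ))
    (clock := fun x => x 0) h3.1 l
  simp only [h4]
  rw [h3.2, sum_range_succ, mul_add, mul_sum]
  simp only [mul_comm]

lemma sum_treeMass (r N : ℕ) : ∑ u ∈ range N, treeMass D y r u =
    ∑ k ∈ range r, ∑ w ∈ range (N * D ^ (r - k)), (y k w).natAbs := by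
  induction r generalizing N with
  | zero => simp [treeMass]
  | succ r ih =>
    simp only [treeMass]
    rw [← sum_range_mul_eq (fun w => (y r w).natAbs + treeMass D y r w), sum_add_distrib, ih,
      sum_range_succ, Nat.add_sub_cancel_left, pow_one, add_comm]
    congr 1
    refine sum_congr rfl fun k hk => ?_
    rw [Nat.sub_add_comm (mem_range.1 hk).le, pow_succ', mul_assoc]

/-- An upper bound for the length of `treeProgram`, up to one instruction. -/
def treeCost (D : ℕ) (y : ℕ → ℕ → ℤ) : ℕ → ℕ → ℕ
  | 0, _ => 0
  | r + 1, u => ∑ c ∈ range D, (2 * (y r (u * D + c)).natAbs + treeCost D y r (u * D + c)) +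
      (D + 1) * treeMass D y (r + 1) u

lemma length_treeProgram_le (r u : ℕ) : (treeProgram D y r u).length ≤ 1 + treeCost D y r u := by
  induction r generalizing u with
  | zero => simp [treeProgram]
  | succ r ih =>
    rw [treeProgram, treeCost]
    split_ifs with h
    · simp
    · have h1 : ((List.range D).flatMap fun c => addProgram (y r (u * D + c)) ++
          treeProgram D y r (u * D + c) ++ addProgram (- y r (u * D + c))).length ≤
          ∑ c ∈ range D, (2 * (y r (u * D + c)).natAbs + treeCost D y r (u * D + c)) + D := by
        have : ∀ n, ((List.range n).flatMap fun c => addProgram (y r (u * D + c)) ++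
            treeProgram D y r (u * D + c) ++ addProgram (- y r (u * D + c))).length ≤
            ∑ c ∈ range n, (2 * (y r (u * D + c)).natAbs + treeCost D y r (u * D + c)) + n := by
          intro n
          induction n with
          | zero => simp
          | succ n hn =>
            have := ih (u * D + n)
            rw [List.range_succ, List.flatMap_append, List.length_append, List.flatMap_singleton,
              sum_range_succ, List.length_append, List.length_append, length_addProgram,
              length_addProgram, Int.natAbs_neg]
            omega
        exact this D
      have h2 : D + 1 ≤ (D + 1) * treeMass D y (r + 1) u :=
        Nat.le_mul_of_pos_right _ (Nat.pos_of_ne_zero h)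
      rw [List.length_append, List.length_append, List.length_singleton, List.length_singleton]
      omega

lemma sum_treeCost (r N : ℕ) : ∑ u ∈ range N, treeCost D y r u =
    ∑ k ∈ range r, (2 + (D + 1) * (r - k)) * ∑ w ∈ range (N * D ^ (r - k)), (y k w).natAbs := by
  induction r generalizing N with
  | zero => simp [treeCost]
  | succ r ih =>
    simp only [treeCost]
    have key : ∑ k ∈ range r, (2 + (D + 1) * (r + 1 - k)) *
        ∑ w ∈ range (N * D ^ (r + 1 - k)), (y k w).natAbs =
        ∑ k ∈ range r, (2 + (D + 1) * (r - k)) * ∑ w ∈ range (N * D * D ^ (r - k)), (y k w).natAbs +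
        (D + 1) * ∑ k ∈ range r, ∑ w ∈ range (N * D ^ (r + 1 - k)), (y k w).natAbs := by
      rw [mul_sum, ← sum_add_distrib]
      refine sum_congr rfl fun k hk => ?_
      rw [Nat.sub_add_comm (mem_range.1 hk).le, pow_succ', mul_assoc]
      ring
    rw [sum_add_distrib, ← mul_sum, sum_treeMass,
      ← sum_range_mul_eq (fun w => 2 * (y r w).natAbs + treeCost D y r w), sum_add_distrib, ih,
      ← mul_sum, sum_range_succ, sum_range_succ, Nat.add_sub_cancel_left, pow_one, key]
    ring

lemma length_forestProgram_le (z : ℕ → ℤ) (r n : ℕ) :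
    (forestProgram D y z r n).length ≤ n + ∑ u ∈ range n, (z u).natAbs +
      ∑ k ∈ range r, (2 + (D + 1) * (r - k)) * ∑ w ∈ range (n * D ^ (r - k)), (y k w).natAbs := by
  rw [← sum_treeCost]
  unfold forestProgram
  induction n with
  | zero => simp
  | succ n ih =>
    have := length_treeProgram_le (D := D) (y := y) r n
    rw [List.range_succ, List.flatMap_append, List.length_append, List.flatMap_singleton,
      sum_range_succ, sum_range_succ, List.length_append, length_addProgram]
    omega

end Traversal

section TreePartition

variable {X : Type*} [MeasurableSpace X] {μ : Measure X} {D : ℕ} {idx : ℕ → X → ℕ}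

/-- The functions `idx ℓ` number the cells of a nested sequence of partitions, where each cell of
level `ℓ` has measure `D ^ (-ℓ)` and is divided into `D` cells of the next level. -/
structure TreePartition (D : ℕ) (μ : Measure X) (idx : ℕ → X → ℕ) : Prop where
  measurable : ∀ ℓ, Measurable (idx ℓ)
  lt : ∀ ℓ x, idx ℓ x < D ^ ℓ
  div : ∀ ℓ x, idx (ℓ + 1) x / D = idx ℓ x
  measure : ∀ ℓ u, u < D ^ ℓ → μ (idx ℓ ⁻¹' {u}) = ((D : ℝ≥0∞) ^ ℓ)⁻¹

/-- The mean value of `f` on the cell with number `u` of level `ℓ`. -/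
def cellMean (μ : Measure X) (idx : ℕ → X → ℕ) (f : X → ℝ) (ℓ u : ℕ) : ℝ :=
  ∫ y, f y ∂ProbabilityTheory.cond μ (idx ℓ ⁻¹' {u})

/-- The difference of the mean values on a cell and on its parent. -/
def cellDetail (μ : Measure X) (D : ℕ) (idx : ℕ → X → ℕ) (f : X → ℝ) (ℓ u : ℕ) : ℝ :=
  cellMean μ idx f (ℓ + 1) u - cellMean μ idx f ℓ (u / D)

lemma enorm_sub_integral_rpow_le {ν : Measure X} [IsProbabilityMeasure ν] {f : X → ℝ}
    (hf : Integrable f ν) {q : ℝ} (hq : 1 ≤ q) (a : ℝ) :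
    ‖a - ∫ y, f y ∂ν‖ₑ ^ q ≤ ∫⁻ y, ‖a - f y‖ₑ ^ q ∂ν := by
  have hq0 : 0 < q := by linarith
  have h1 : a - ∫ y, f y ∂ν = ∫ y, a - f y ∂ν := by
    rw [integral_sub (integrable_const a) hf]; simp
  have hm : AEStronglyMeasurable (fun y => a - f y) ν :=
    aestronglyMeasurable_const.sub hf.aestronglyMeasurable
  have h2 : ‖∫ y, a - f y ∂ν‖ₑ ≤ eLpNorm (fun y => a - f y) (ENNReal.ofReal q) ν := by
    refine (enorm_integral_le_lintegral_enorm _).trans ?_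
    rw [← eLpNorm_one_eq_lintegral_enorm]
    exact eLpNorm_le_eLpNorm_of_exponent_le (by simpa using ENNReal.ofReal_le_ofReal hq) hm
  rw [h1]
  refine (ENNReal.rpow_le_rpow h2 hq0.le).trans ?_
  rw [eLpNorm_eq_lintegral_rpow_enorm_toReal (by simpa using hq0) (by simp),
    ENNReal.toReal_ofReal hq0.le, ← ENNReal.rpow_mul, one_div_mul_cancel hq0.ne', ENNReal.rpow_one]

namespace TreePartition

variable (hT : TreePartition D μ idx)
include hT

lemma measurableSet_cell (ℓ u : ℕ) : MeasurableSet (idx ℓ ⁻¹' {u}) :=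
  hT.measurable ℓ (measurableSet_singleton u)

lemma isProbabilityMeasure_cond [IsFiniteMeasure μ] {ℓ u : ℕ} (hu : u < D ^ ℓ) :
    IsProbabilityMeasure (ProbabilityTheory.cond μ (idx ℓ ⁻¹' {u})) := by
  refine ProbabilityTheory.cond_isProbabilityMeasure ?_
  rw [hT.measure ℓ u hu]
  exact ENNReal.inv_ne_zero.2 (ENNReal.pow_ne_top (by simp))

lemma lintegral_cond {ℓ u : ℕ} (hu : u < D ^ ℓ) (g : X → ℝ≥0∞) :
    ∫⁻ y, g y ∂ProbabilityTheory.cond μ (idx ℓ ⁻¹' {u}) =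
      (D : ℝ≥0∞) ^ ℓ * ∫⁻ y in idx ℓ ⁻¹' {u}, g y ∂μ := by
  rw [ProbabilityTheory.cond, lintegral_smul_measure, hT.measure ℓ u hu, inv_inv, smul_eq_mul]

lemma integrable_cond {f : X → ℝ} (hf : Integrable f μ) {ℓ u : ℕ} (hu : u < D ^ ℓ) :
    Integrable f (ProbabilityTheory.cond μ (idx ℓ ⁻¹' {u})) := by
  refine Integrable.smul_measure hf.restrict ?_
  rw [hT.measure ℓ u hu, inv_inv]
  exact ENNReal.pow_ne_top (by simp)

lemma sum_lintegral_cell (ℓ : ℕ) (g : X → ℝ≥0∞) :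
    ∑ u ∈ range (D ^ ℓ), ∫⁻ y in idx ℓ ⁻¹' {u}, g y ∂μ = ∫⁻ y, g y ∂μ := by
  rw [← lintegral_biUnion_finset (fun u _ v _ huv => ?_) fun u _ => hT.measurableSet_cell ℓ u]
  · have : ⋃ u ∈ range (D ^ ℓ), idx ℓ ⁻¹' {u} = Set.univ := by
      ext x; simpa using hT.lt ℓ x
    rw [this, Measure.restrict_univ]
  · exact Set.disjoint_left.2 fun x hx hy => huv (hx.symm.trans hy)

lemma lintegral_enorm_sub_cellMean_le [IsProbabilityMeasure μ] {f : X → ℝ} (hf : Integrable f μ)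
    {q : ℝ} (hq : 1 ≤ q) (ℓ : ℕ) :
    ∫⁻ x, ‖f x - cellMean μ idx f ℓ (idx ℓ x)‖ₑ ^ q ∂μ ≤
      (D : ℝ≥0∞) ^ ℓ * ∫⁻ x, ∫⁻ y in idx ℓ ⁻¹' {idx ℓ x}, ‖f x - f y‖ₑ ^ q ∂μ ∂μ := by
  rw [← lintegral_const_mul' _ _ (ENNReal.pow_ne_top (by simp))]
  refine lintegral_mono fun x => ?_
  have := hT.isProbabilityMeasure_cond (hT.lt ℓ x)
  exact (enorm_sub_integral_rpow_le (hT.integrable_cond hf (hT.lt ℓ x)) hq _).trans_eq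
    (hT.lintegral_cond (hT.lt ℓ x) _)

lemma sum_enorm_cellDetail_le [IsProbabilityMeasure μ] {f : X → ℝ} (hf : Integrable f μ)
    {q : ℝ} (hq : 1 ≤ q) (ℓ : ℕ) :
    ∑ u ∈ range (D ^ (ℓ + 1)), ‖cellDetail μ D idx f ℓ u‖ₑ ^ q ≤
      (D : ℝ≥0∞) ^ (ℓ + 1) * ∫⁻ x, ‖f x - cellMean μ idx f ℓ (idx ℓ x)‖ₑ ^ q ∂μ := by
  rw [← hT.sum_lintegral_cell (ℓ + 1), mul_sum]
  refine sum_le_sum fun u hu => ?_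
  rw [mem_range] at hu
  have := hT.isProbabilityMeasure_cond hu
  have h1 := enorm_sub_integral_rpow_le (hT.integrable_cond hf hu) hq (cellMean μ idx f ℓ (u / D))
  rw [hT.lintegral_cond hu] at h1
  rw [cellDetail, cellMean, ← enorm_neg, neg_sub]
  refine h1.trans_eq ?_
  congr 1
  refine setLIntegral_congr_fun (hT.measurableSet_cell _ _) fun x hx => ?_
  have hx : idx (ℓ + 1) x = u := hx
  rw [← hT.div ℓ x, hx, ← enorm_neg, neg_sub]

lemma eLpNorm_comp_le [IsProbabilityMeasure μ] {q : ℝ} {p : ℝ≥0∞} (hq : 1 ≤ q)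
    (hqp : ENNReal.ofReal q ≤ p) {ℓ : ℕ} {w : ℕ → ℝ} {M N : ℝ} (hN : 0 ≤ N)
    (hM : ∀ u < D ^ ℓ, |w u| ≤ M)
    (hw : ∑ u ∈ range (D ^ ℓ), |w u| ^ q ≤ (D : ℝ) ^ ℓ * N ^ q) :
    eLpNorm (fun x => w (idx ℓ x)) p μ ≤
      ENNReal.ofReal (M ^ (1 - q / p.toReal) * N ^ (q / p.toReal)) := by
  obtain ⟨x⟩ : Nonempty X := μ.nonempty_of_neZero
  have hM0 : 0 ≤ M := (abs_nonneg _).trans (hM _ (hT.lt ℓ x))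
  rcases eq_or_ne p ∞ with rfl | hp
  · simp only [ENNReal.toReal_top, _root_.div_zero, _root_.sub_zero, Real.rpow_one, Real.rpow_zero, mul_one]
    rw [eLpNorm_exponent_top]
    refine eLpNormEssSup_le_of_ae_bound (.of_forall fun x => hM _ (hT.lt ℓ x))
  · have hp0 : p ≠ 0 := fun h => by
      rw [h] at hqp; simp at hqp; linarith
    have hqp' : q ≤ p.toReal := (ENNReal.ofReal_le_iff_le_toReal hp).1 hqp
    have hP : 0 < p.toReal := by linarith
    have hD : (0 : ℝ) < (D : ℝ) ^ ℓ := by exact_mod_cast (Nat.zero_le _).trans_lt (hT.lt ℓ x)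
    have h1 : ∑ u ∈ range (D ^ ℓ), |w u| ^ p.toReal ≤
        (D : ℝ) ^ ℓ * (M ^ (p.toReal - q) * N ^ q) := by
      calc ∑ u ∈ range (D ^ ℓ), |w u| ^ p.toReal
          ≤ ∑ u ∈ range (D ^ ℓ), M ^ (p.toReal - q) * |w u| ^ q := by
            refine sum_le_sum fun u hu => ?_
            have h2 : |w u| ^ p.toReal = |w u| ^ (p.toReal - q) * |w u| ^ q := by
              rw [← Real.rpow_add_of_nonneg (abs_nonneg _) (by linarith) (by linarith),
                sub_add_cancel]
            rw [h2]
            exact mul_le_mul_of_nonneg_right (Real.rpow_le_rpow (abs_nonneg _)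
              (hM u (mem_range.1 hu)) (by linarith)) (by positivity)
        _ ≤ M ^ (p.toReal - q) * ((D : ℝ) ^ ℓ * N ^ q) := by
            rw [← mul_sum]
            exact mul_le_mul_of_nonneg_left hw (by positivity)
        _ = _ := by ring
    have h2 : M ^ (p.toReal - q) * N ^ q =
        (M ^ (1 - q / p.toReal) * N ^ (q / p.toReal)) ^ p.toReal := by
      rw [Real.mul_rpow (by positivity) (by positivity), ← Real.rpow_mul hM0, ← Real.rpow_mul hN]
      congr 2 <;> field_simp
    rw [eLpNorm_eq_lintegral_rpow_enorm_toReal hp0 hp, one_div, ENNReal.rpow_inv_le_iff hP,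
      ENNReal.ofReal_rpow_of_nonneg (by positivity) hP.le, ← h2, ← hT.sum_lintegral_cell ℓ]
    have h3 : ∀ u ∈ range (D ^ ℓ), ∫⁻ y in idx ℓ ⁻¹' {u}, ‖w (idx ℓ y)‖ₑ ^ p.toReal ∂μ =
        ENNReal.ofReal (((D : ℝ) ^ ℓ)⁻¹ * |w u| ^ p.toReal) := by
      intro u hu
      rw [setLIntegral_congr_fun (g := fun _ => ‖w u‖ₑ ^ p.toReal) (hT.measurableSet_cell ℓ u)
        fun y hy => by rw [show idx ℓ y = u from hy], setLIntegral_const,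
        hT.measure ℓ u (mem_range.1 hu), mul_comm, Real.enorm_eq_ofReal_abs,
        ENNReal.ofReal_rpow_of_nonneg (abs_nonneg _) hP.le, ENNReal.ofReal_mul (by positivity),
        ENNReal.ofReal_inv_of_pos hD, ENNReal.ofReal_pow (by positivity), ENNReal.ofReal_natCast]
    rw [sum_congr rfl h3, ← ENNReal.ofReal_sum_of_nonneg fun u _ => by positivity, ← mul_sum]
    refine ENNReal.ofReal_le_ofReal ?_
    rwa [inv_mul_le_iff₀ hD]

end TreePartition

end TreePartition

lemma mul_pow_rpow_interpolate {A x y t : ℝ} (hA : 0 ≤ A) (hx : 0 ≤ x) (hy : 0 ≤ y)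
    (ht0 : 0 ≤ t) (ht1 : t ≤ 1) (n : ℕ) :
    (A * x ^ n) ^ (1 - t) * (A * y ^ n) ^ t = A * (x ^ (1 - t) * y ^ t) ^ n := by
  have h : A ^ (1 - t) * A ^ t = A := by
    rw [← Real.rpow_add_of_nonneg hA (by linarith) ht0, sub_add_cancel, Real.rpow_one]
  rw [Real.mul_rpow hA (by positivity), Real.mul_rpow hA (by positivity), mul_pow,
    ← Real.rpow_natCast_mul hx, ← Real.rpow_natCast_mul hy, ← Real.rpow_mul_natCast hx,
    ← Real.rpow_mul_natCast hy, mul_comm (n : ℝ), mul_comm (n : ℝ)]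
  calc _ = (A ^ (1 - t) * A ^ t) * (x ^ ((1 - t) * n) * y ^ (t * n)) := by ring
    _ = _ := by rw [h]

lemma geom_sum_Ico_le {g : ℝ} (h0 : 0 ≤ g) (h1 : g < 1) (m n : ℕ) :
    ∑ k ∈ Ico m n, g ^ k ≤ g ^ m / (1 - g) := by
  rcases le_or_gt m n with h | h
  · rw [geom_sum_Ico' h1.ne h]
    have : 0 < 1 - g := by linarith
    gcongr
    have : 0 ≤ g ^ n := by positivity
    linarith
  · rw [Ico_eq_empty (by omega), sum_empty]
    have : 0 < 1 - g := by linarith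
    positivity

section TreeSmooth

variable {X : Type*} [MeasurableSpace X] {μ : Measure X} {D : ℕ} {idx : ℕ → X → ℕ}

/-- `f` belongs to a ball of radius `A` of the Besov type space with rate `θ` on the tree. -/
structure TreeSmooth (D : ℕ) (μ : Measure X) (idx : ℕ → X → ℕ) (q θ A : ℝ) (f : X → ℝ) :
    Prop where
  integrable : Integrable f μ
  mean : |cellMean μ idx f 0 0| ≤ A
  detail : ∀ ℓ, ∑ u ∈ range (D ^ (ℓ + 1)), |cellDetail μ D idx f ℓ u| ^ q ≤
    (D : ℝ) ^ (ℓ + 1) * (A * θ ^ (ℓ + 1)) ^ q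
  tendsto : Filter.Tendsto (fun ℓ => eLpNorm (fun x => cellMean μ idx f ℓ (idx ℓ x) - f x)
    (ENNReal.ofReal q) μ) Filter.atTop (nhds 0)

lemma TreePartition.measurable_comp (hT : TreePartition D μ idx) (w : ℕ → ℝ) (ℓ : ℕ) :
    Measurable fun x => w (idx ℓ x) :=
  (measurable_of_countable w).comp (hT.measurable ℓ)

lemma cellMean_sub_cellMean (hT : TreePartition D μ idx) (f : X → ℝ) (x : X) {m n : ℕ}
    (h : m ≤ n) :
    cellMean μ idx f n (idx n x) - cellMean μ idx f m (idx m x) =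
      ∑ ℓ ∈ Ico m n, cellDetail μ D idx f ℓ (idx (ℓ + 1) x) := by
  rw [← sum_Ico_sub (fun ℓ => cellMean μ idx f ℓ (idx ℓ x)) h]
  refine sum_congr rfl fun ℓ _ => ?_
  rw [cellDetail, hT.div]

namespace TreeSmooth

variable {q θ A : ℝ} {f : X → ℝ} (hf : TreeSmooth D μ idx q θ A f)
include hf

lemma abs_cellDetail_le (hq : 1 ≤ q) (hθ : 0 ≤ θ) (hA : 0 ≤ A) (ℓ u : ℕ)
    (hu : u < D ^ (ℓ + 1)) :
    |cellDetail μ D idx f ℓ u| ≤ A * ((D : ℝ) ^ (1 / q) * θ) ^ (ℓ + 1) := by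
  have h1 := (single_le_sum (f := fun u => |cellDetail μ D idx f ℓ u| ^ q)
    (fun u _ => by positivity) (mem_range.2 hu)).trans (hf.detail ℓ)
  have hq0 : 0 < q := by linarith
  refine (Real.rpow_le_rpow_iff (abs_nonneg _) (by positivity) hq0).1 (h1.trans_eq ?_)
  have h2 : (((D : ℝ) ^ (1 / q)) ^ (ℓ + 1)) ^ q = (D : ℝ) ^ (ℓ + 1) := by
    rw [← Real.rpow_natCast_mul (by positivity), mul_comm, Real.rpow_mul_natCast (by positivity),
      ← Real.rpow_mul (by positivity), one_div_mul_cancel hq0.ne', Real.rpow_one]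
  rw [mul_pow, mul_left_comm, Real.mul_rpow (y := A * _) (by positivity) (by positivity), h2]

lemma eLpNorm_cellDetail_le [IsProbabilityMeasure μ] (hT : TreePartition D μ idx) {p : ℝ≥0∞}
    (hq : 1 ≤ q) (hqp : ENNReal.ofReal q ≤ p) (hθ : 0 ≤ θ) (hA : 0 ≤ A)
    (ht : q / p.toReal ≤ 1) (ℓ : ℕ) :
    eLpNorm (fun x => cellDetail μ D idx f ℓ (idx (ℓ + 1) x)) p μ ≤
      ENNReal.ofReal (A * (((D : ℝ) ^ (1 / q) * θ) ^ (1 - q / p.toReal) *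
        θ ^ (q / p.toReal)) ^ (ℓ + 1)) := by
  rw [← mul_pow_rpow_interpolate hA (by positivity) hθ (by positivity) ht]
  exact hT.eLpNorm_comp_le hq hqp (by positivity)
    (fun u hu => hf.abs_cellDetail_le hq hθ hA ℓ u hu) (hf.detail ℓ)

lemma eLpNorm_sub_cellMean_le [IsProbabilityMeasure μ] (hT : TreePartition D μ idx) {p : ℝ≥0∞}
    (hq : 1 ≤ q) (hqp : ENNReal.ofReal q ≤ p) (hθ : 0 ≤ θ) (hA : 0 ≤ A)
    (ht : q / p.toReal ≤ 1) {g : ℝ}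
    (hg : g = ((D : ℝ) ^ (1 / q) * θ) ^ (1 - q / p.toReal) * θ ^ (q / p.toReal)) (hg1 : g < 1)
    (m : ℕ) :
    eLpNorm (fun x => f x - cellMean μ idx f m (idx m x)) p μ ≤
      ENNReal.ofReal (A * (g ^ (m + 1) / (1 - g))) := by
  have hg0 : 0 ≤ g := by rw [hg]; positivity
  have hp1 : 1 ≤ p := le_trans (by simpa using ENNReal.ofReal_le_ofReal hq) hqp
  have hm : ∀ ℓ, AEStronglyMeasurable (fun x => cellMean μ idx f ℓ (idx ℓ x)) μ := fun ℓ =>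
    (hT.measurable_comp _ ℓ).aestronglyMeasurable
  obtain ⟨ns, hns, hlim⟩ := (tendstoInMeasure_of_tendsto_eLpNorm
    (by simp; linarith) hm hf.integrable.aestronglyMeasurable hf.tendsto).exists_seq_tendsto_ae
  refine Lp.eLpNorm_le_of_ae_tendsto (u := Filter.atTop)
    (f := fun n x => cellMean μ idx f (ns n) (idx (ns n) x) - cellMean μ idx f m (idx m x))
    ?_ (fun n => (hm _).sub (hm _)) ?_
  · filter_upwards [hns.tendsto_atTop.eventually_ge_atTop m] with n hn
    simp only [cellMean_sub_cellMean hT f _ hn]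
    have : (fun x => ∑ ℓ ∈ Ico m (ns n), cellDetail μ D idx f ℓ (idx (ℓ + 1) x)) =
        ∑ ℓ ∈ Ico m (ns n), fun x => cellDetail μ D idx f ℓ (idx (ℓ + 1) x) := by
      ext x; simp
    rw [this]
    refine (eLpNorm_sum_le (fun ℓ _ => (hT.measurable_comp _ _).aestronglyMeasurable) hp1).trans ?_
    refine (sum_le_sum fun ℓ _ => hf.eLpNorm_cellDetail_le hT hq hqp hθ hA ht ℓ).trans ?_
    rw [← hg, ← ENNReal.ofReal_sum_of_nonneg fun ℓ _ => by positivity, ← mul_sum]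
    refine ENNReal.ofReal_le_ofReal (mul_le_mul_of_nonneg_left ?_ hA)
    simp only [pow_succ]
    rw [← sum_mul, mul_div_right_comm]
    exact mul_le_mul_of_nonneg_right (geom_sum_Ico_le hg0 hg1 _ _) hg0
  · filter_upwards [hlim] with x hx
    exact hx.sub_const _

lemma sum_abs_cellDetail_le (hq : 1 ≤ q) (hθ : 0 ≤ θ) (hA : 0 ≤ A) (ℓ : ℕ) :
    ∑ u ∈ range (D ^ (ℓ + 1)), |cellDetail μ D idx f ℓ u| ≤ A * ((D : ℝ) * θ) ^ (ℓ + 1) := by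
  have hq0 : 0 < q := by linarith
  have h1 := Real.rpow_sum_le_const_mul_sum_rpow (range (D ^ (ℓ + 1)))
    (fun u => cellDetail μ D idx f ℓ u) hq
  refine (Real.rpow_le_rpow_iff (sum_nonneg fun _ _ => abs_nonneg _) (by positivity) hq0).1 ?_
  refine h1.trans ((mul_le_mul_of_nonneg_left (hf.detail ℓ) (by positivity)).trans_eq ?_)
  have h2 : ((D : ℝ) ^ (ℓ + 1)) ^ (q - 1) * (D : ℝ) ^ (ℓ + 1) = ((D : ℝ) ^ (ℓ + 1)) ^ q := by
    nth_rw 2 [← Real.rpow_one ((D : ℝ) ^ (ℓ + 1))]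
    rcases Nat.eq_zero_or_pos D with rfl | hD
    · simp [hq0.ne']
    · rw [← Real.rpow_add (by positivity), sub_add_cancel]
  rw [card_range, Nat.cast_pow, ← mul_assoc, h2, mul_pow, mul_left_comm A,
    Real.mul_rpow (y := A * _) (by positivity) (by positivity)]

end TreeSmooth

/-- The increments of a sequence. -/
def jump {G : Type*} [Zero G] [Sub G] (c : ℕ → G) (u : ℕ) : G :=
  c u - if u = 0 then 0 else c (u - 1)

lemma sum_range_succ_jump (c : ℕ → ℤ) (n : ℕ) : ∑ u ∈ range (n + 1), jump c u = c n := by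
  induction n with
  | zero => simp [jump]
  | succ n ih => rw [sum_range_succ, ih]; simp [jump]

lemma sum_abs_jump_div (c : ℕ → ℝ) (n : ℕ) {D : ℕ} (hD : 0 < D) :
    ∑ u ∈ range (n * D), |jump (fun u => c (u / D)) u| = ∑ u ∈ range n, |jump c u| := by
  rw [sum_range_mul_eq]
  refine sum_congr rfl fun i _ => ?_
  rw [sum_eq_single_of_mem 0 (mem_range.2 hD)]
  · rcases Nat.eq_zero_or_pos i with rfl | hi
    · simp [jump]
    · obtain ⟨i, rfl⟩ := Nat.exists_eq_succ_of_ne_zero hi.ne'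
      have h1 : (i + 1) * D - 1 = D - 1 + D * i := by
        obtain ⟨D, rfl⟩ := Nat.exists_eq_succ_of_ne_zero hD.ne'
        simp only [Nat.succ_eq_add_one, add_mul, one_mul, ← add_assoc, Nat.add_sub_cancel]; ring
      have h2 : ((i + 1) * D - 1) / D = i := by
        rw [h1, Nat.add_mul_div_left _ _ hD, Nat.div_eq_of_lt (by omega), zero_add]
      simp [jump, hD.ne', h2, Nat.mul_div_cancel _ hD]
  · intro j hj hj0
    have hj := mem_range.1 hj
    have h1 : (i * D + j) / D = i := by
      rw [mul_comm, Nat.mul_add_div hD, Nat.div_eq_of_lt hj, add_zero]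
    have h2 : (i * D + j - 1) / D = i := by
      rw [Nat.add_sub_assoc (by omega), mul_comm, Nat.mul_add_div hD,
        Nat.div_eq_of_lt (by omega), add_zero]
    simp [jump, h1, h2, hj0]

lemma sum_abs_jump_add_le (c e : ℕ → ℝ) (n : ℕ) :
    ∑ u ∈ range n, |jump (fun u => c u + e u) u| ≤
      ∑ u ∈ range n, |jump c u| + 2 * ∑ u ∈ range n, |e u| := by
  have h1 : ∀ u, |jump (fun u => c u + e u) u| ≤
      |jump c u| + (|e u| + if u = 0 then 0 else |e (u - 1)|) := by
    intro u
    unfold jump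
    split_ifs with h
    · simpa using abs_add_le (c u) (e u)
    · calc |c u + e u - (c (u - 1) + e (u - 1))|
          = |(c u - c (u - 1)) + (e u - e (u - 1))| := by ring_nf
        _ ≤ _ := (abs_add_le _ _).trans (by gcongr; exact abs_sub _ _)
  refine (sum_le_sum fun u _ => h1 u).trans ?_
  rw [sum_add_distrib, sum_add_distrib, two_mul]
  refine add_le_add_right (add_le_add_right ?_ _) _
  cases n with
  | zero => simp
  | succ n =>
    rw [sum_range_succ', sum_range_succ]
    simp

lemma natAbs_jump_floor_le (c : ℕ → ℝ) (u : ℕ) :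
    ((jump (fun u => ⌊c u⌋) u).natAbs : ℝ) ≤ |jump c u| + 1 := by
  rw [Nat.cast_natAbs, Int.cast_abs, jump, jump]
  split_ifs with h
  · have h1 := Int.floor_le (c u)
    have h2 := Int.lt_floor_add_one (c u)
    simp only [_root_.sub_zero]
    rw [abs_le]
    constructor <;> cases abs_cases (c u) <;> linarith
  · have h1 := Int.floor_le (c u)
    have h2 := Int.lt_floor_add_one (c u)
    have h3 := Int.floor_le (c (u - 1))
    have h4 := Int.lt_floor_add_one (c (u - 1))
    push_cast
    rw [abs_le]
    constructor <;> cases abs_cases (c u - c (u - 1)) <;> linarith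

end TreeSmooth

lemma exists_int_quantization (t : ℝ) {q : ℝ} (hq : 1 ≤ q) :
    ∃ x : ℤ, |t - x| ≤ |t| ∧ |t - x| ≤ 1 ∧ (x.natAbs : ℝ) ≤ |t| ^ q := by
  have key : ∀ t : ℝ, 0 ≤ t →
      ∃ x : ℤ, |t - x| ≤ |t| ∧ |t - x| ≤ 1 ∧ (x.natAbs : ℝ) ≤ |t| ^ q := by
    intro t ht
    have h1 := Nat.floor_le ht
    have h2 := Nat.lt_floor_add_one t
    refine ⟨⌊t⌋₊, ?_, ?_, ?_⟩
    · rw [Int.cast_natCast, abs_of_nonneg (by linarith), abs_of_nonneg ht]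
      have : (0 : ℝ) ≤ ⌊t⌋₊ := by positivity
      linarith
    · rw [Int.cast_natCast, abs_of_nonneg (by linarith)]
      linarith
    · rw [Int.natAbs_natCast, abs_of_nonneg ht]
      rcases lt_or_ge t 1 with h | h
      · rw [Nat.floor_eq_zero.2 h]
        simpa using Real.rpow_nonneg ht q
      · exact h1.trans (Real.self_le_rpow_of_one_le h hq)
  rcases le_total 0 t with ht | ht
  · exact key t ht
  · obtain ⟨x, h1, h2, h3⟩ := key (-t) (by linarith)
    have h4 : |t - ((-x : ℤ) : ℝ)| = |-t - x| := by
      rw [← abs_neg]; push_cast; ring_nf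
    exact ⟨-x, by rwa [h4, ← abs_neg t], by rwa [h4], by rwa [Int.natAbs_neg, ← abs_neg t]⟩

lemma exists_rpow_mul_lt_one {R t θ : ℝ} (hR : 0 < R) (h : R ^ (1 - t) * θ < 1) : ∃ Λ, R < Λ ∧ Λ ^ (1 - t) * θ < 1 := by
  have h1 : ContinuousAt (fun x : ℝ => x ^ (1 - t) * θ) R :=
    (Real.continuousAt_rpow_const _ _ (Or.inl hR.ne')).mul continuousAt_const
  have h2 := h1.eventually (gt_mem_nhds h)
  obtain ⟨ε, hε, h3⟩ := Metric.eventually_nhds_iff.1 h2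
  refine ⟨R + ε / 2, by linarith, h3 ?_⟩
  rw [Real.dist_eq, add_sub_cancel_left, abs_of_pos (by linarith)]
  linarith

section

variable {X : Type*} [MeasurableSpace X] {μ : Measure X} {D : ℕ} {idx : ℕ → X → ℕ}

namespace TreeSmooth

variable {q θ A : ℝ} {f : X → ℝ} (hf : TreeSmooth D μ idx q θ A f)
include hf

lemma sum_abs_jump_cellMean_le (hD : 0 < D) (hq : 1 ≤ q) (hθ : 0 ≤ θ) (hA : 0 ≤ A)
    (hDθ : 1 < D * θ) (ℓ : ℕ) :
    ∑ u ∈ range (D ^ ℓ), |jump (cellMean μ idx f ℓ) u| ≤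
      2 * A * (D * θ / (D * θ - 1)) * (D * θ) ^ ℓ := by
  have h0 : 0 < D * θ - 1 := by linarith
  induction ℓ with
  | zero =>
    have h1 : 1 ≤ D * θ / (D * θ - 1) := by rw [le_div_iff₀ h0]; linarith
    have h2 := hf.mean
    simp only [pow_zero, range_one, sum_singleton, jump, if_true, _root_.sub_zero, mul_one]
    nlinarith
  | succ ℓ ih =>
    have h1 : cellMean μ idx f (ℓ + 1) =
        fun u => cellMean μ idx f ℓ (u / D) + cellDetail μ D idx f ℓ u := by
      ext u; rw [cellDetail]; ring
    rw [h1]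
    refine (sum_abs_jump_add_le _ _ _).trans ?_
    rw [pow_succ D, sum_abs_jump_div _ _ hD, ← pow_succ D]
    refine (add_le_add ih (mul_le_mul_of_nonneg_left
      (hf.sum_abs_cellDetail_le hq hθ hA ℓ) zero_le_two)).trans_eq ?_
    field_simp
    ring

/-- Quantization of the mean values on the cells of level `n`. -/
lemma sum_natAbs_jump_floor_le (hD : 0 < D) (hq : 1 ≤ q) (hθ : 0 < θ) (hA : 0 ≤ A)
    (hDθ : 1 < D * θ) (n : ℕ) :
    ((∑ u ∈ range (D ^ n),
      (jump (fun u => ⌊cellMean μ idx f n u / θ ^ n⌋) u).natAbs : ℕ) : ℝ) ≤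
      (2 * A * (D * θ / (D * θ - 1)) + 1) * (D : ℝ) ^ n := by
  push_cast
  refine (sum_le_sum fun u _ => natAbs_jump_floor_le _ u).trans ?_
  have h1 : ∀ u, |jump (fun u => cellMean μ idx f n u / θ ^ n) u| =
      |jump (cellMean μ idx f n) u| / θ ^ n := by
    intro u
    rw [← abs_of_pos (pow_pos hθ n), ← abs_div, abs_of_pos (pow_pos hθ n), jump, jump, sub_div]
    congr 2
    split_ifs <;> simp
  simp only [h1]
  rw [sum_add_distrib, ← sum_div]
  simp only [sum_const, card_range, nsmul_eq_mul, mul_one, Nat.cast_pow]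
  rw [add_mul, one_mul]
  gcongr
  rw [div_le_iff₀ (by positivity), mul_assoc, ← mul_pow]
  exact hf.sum_abs_jump_cellMean_le hD hq hθ.le hA hDθ n

/-- Quantization of the details of level `n + k` with step `θ ^ n * (Λ * θ) ^ (k + 1)`. -/
lemma exists_quantization [IsProbabilityMeasure μ] (hT : TreePartition D μ idx)
    {p : ℝ≥0∞} (hq : 1 ≤ q) (hqp : ENNReal.ofReal q ≤ p) (hθ : 0 < θ) (hA : 1 ≤ A)
    (ht : q / p.toReal ≤ 1) {Λ : ℝ} (hΛ : 0 < Λ) (n k : ℕ) :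
    ∃ x : ℕ → ℤ,
      ((∑ u ∈ range (D ^ (n + k + 1)), (x u).natAbs : ℕ) : ℝ) ≤
        A ^ q * D ^ n * (D / Λ ^ q) ^ (k + 1) ∧
      eLpNorm (fun y => cellDetail μ D idx f (n + k) (idx (n + k + 1) y) -
          θ ^ n * (Λ * θ) ^ (k + 1) * x (idx (n + k + 1) y)) p μ ≤
        ENNReal.ofReal (A * θ ^ n * (Λ ^ (1 - q / p.toReal) * θ) ^ (k + 1)) := by
  have hA0 : 0 ≤ A := by linarith
  have hq0 : 0 < q := by linarith
  set δ := θ ^ n * (Λ * θ) ^ (k + 1) with hδ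
  have hδ0 : 0 < δ := by positivity
  choose x hx1 hx2 hx3 using fun u =>
    exists_int_quantization (cellDetail μ D idx f (n + k) u / δ) hq
  have herr : ∀ u, |cellDetail μ D idx f (n + k) u - δ * x u| =
      δ * |cellDetail μ D idx f (n + k) u / δ - x u| := by
    intro u
    rw [← abs_of_pos hδ0, ← abs_mul, abs_of_pos hδ0, mul_sub, mul_div_cancel₀ _ hδ0.ne']
  refine ⟨x, ?_, ?_⟩
  · push_cast
    refine (sum_le_sum fun u _ => hx3 u).trans ?_
    have h1 : ∀ u, |cellDetail μ D idx f (n + k) u / δ| ^ q =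
        |cellDetail μ D idx f (n + k) u| ^ q / δ ^ q := by
      intro u
      rw [abs_div, abs_of_pos hδ0, Real.div_rpow (abs_nonneg _) hδ0.le]
    simp only [h1]
    rw [← sum_div, div_le_iff₀ (by positivity)]
    refine (hf.detail (n + k)).trans_eq ?_
    have h2 : A * θ ^ (n + k + 1) = A * δ / Λ ^ (k + 1) := by
      rw [hδ, mul_pow]; field_simp; ring
    rw [h2, Real.div_rpow (by positivity) (by positivity), Real.mul_rpow hA0 hδ0.le,
      ← Real.rpow_natCast_mul hΛ.le, mul_comm ((k + 1 : ℕ) : ℝ), Real.rpow_mul_natCast hΛ.le,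
      div_pow, add_assoc, pow_add]
    ring
  · have h3 := hT.eLpNorm_comp_le (p := p) hq hqp (ℓ := n + k + 1)
      (w := fun u => cellDetail μ D idx f (n + k) u - δ * x u)
      (M := A * θ ^ n * (Λ * θ) ^ (k + 1)) (N := A * θ ^ n * θ ^ (k + 1)) (by positivity) ?_ ?_
    · refine h3.trans (ENNReal.ofReal_le_ofReal (le_of_eq ?_))
      rw [mul_pow_rpow_interpolate (by positivity) (by positivity) hθ.le (by positivity) ht,
        Real.mul_rpow hΛ.le hθ.le, mul_assoc (Λ ^ _), ← Real.rpow_add hθ, sub_add_cancel,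
        Real.rpow_one]
    · intro u _
      rw [herr, mul_assoc A, ← hδ]
      nlinarith [hx2 u]
    · refine (sum_le_sum fun u _ => Real.rpow_le_rpow (abs_nonneg _) (?_ : _ ≤
        |cellDetail μ D idx f (n + k) u|) hq0.le).trans ((hf.detail (n + k)).trans_eq ?_)
      · rw [herr]
        refine (mul_le_mul_of_nonneg_left (hx1 u) hδ0.le).trans_eq ?_
        rw [abs_div, abs_of_pos hδ0, mul_div_cancel₀ _ hδ0.ne']
      · rw [mul_assoc A, ← pow_add, add_assoc]

end TreeSmooth

lemma TreePartition.div_pow (hT : TreePartition D μ idx) (ℓ k : ℕ) (x : X) :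
    idx (ℓ + k) x / D ^ k = idx ℓ x := by
  induction k with
  | zero => simp
  | succ k ih => rw [pow_succ', ← Nat.div_div_eq_div_mul, ← add_assoc, hT.div, ih]

theorem TreePartition.exists_forest_approx [IsProbabilityMeasure μ] (hT : TreePartition D μ idx)
    (hD : 0 < D) {p : ℝ≥0∞} {q θ A : ℝ} (hq : 1 ≤ q) (hqp : ENNReal.ofReal q ≤ p) (hθ : 0 < θ)
    (hA : 1 ≤ A) (ht : q / p.toReal ≤ 1) (hDθ : 1 < D * θ) {g : ℝ}
    (hg : g = ((D : ℝ) ^ (1 / q) * θ) ^ (1 - q / p.toReal) * θ ^ (q / p.toReal)) (hg1 : g < 1) :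
    ∃ C > 0, ∃ ρ : ℝ, ρ ≠ 0 ∧ ∀ f : X → ℝ, TreeSmooth D μ idx q θ A f → ∀ n K : ℕ,
      g ^ (n + K + 1) ≤ θ ^ n → ∃ (y : ℕ → ℕ → ℤ) (z : ℕ → ℤ),
        ((D ^ n + ∑ u ∈ range (D ^ n), (z u).natAbs + ∑ k ∈ range K, (2 + (D + 1) * (K - k)) *
          ∑ w ∈ range (D ^ n * D ^ (K - k)), (y k w).natAbs : ℕ) : ℝ) ≤ C * D ^ n ∧
        eLpNorm (fun x => f x - (θ ^ n * ∑ u ∈ range (idx (n + K) x / D ^ K + 1), (z u : ℝ) +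
          ∑ k ∈ range K, θ ^ n * ρ ^ (K - k) * y k (idx (n + K) x / D ^ k))) p μ ≤
            ENNReal.ofReal (C * θ ^ n) := by
  have hq0 : 0 < q := by linarith
  have hp1 : 1 ≤ p := le_trans (by simpa using ENNReal.ofReal_le_ofReal hq) hqp
  have hR : 0 < (D : ℝ) ^ (1 / q) := by positivity
  have hg' : g = ((D : ℝ) ^ (1 / q)) ^ (1 - q / p.toReal) * θ := by
    rw [hg, Real.mul_rpow hR.le hθ.le, mul_assoc, ← Real.rpow_add hθ, sub_add_cancel,
      Real.rpow_one]
  obtain ⟨Λ, hΛ, hΛ1⟩ := exists_rpow_mul_lt_one hR (hg' ▸ hg1)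
  have hΛ0 : 0 < Λ := hR.trans hΛ
  set lam := Λ ^ (1 - q / p.toReal) * θ with hlam
  have hlam0 : 0 < lam := by positivity
  set τ := D / Λ ^ q with hτ
  have hτ0 : 0 ≤ τ := by positivity
  have hτ1 : τ < 1 := by
    rw [hτ, div_lt_one (by positivity)]
    calc (D : ℝ) = ((D : ℝ) ^ (1 / q)) ^ q := by
          rw [← Real.rpow_mul (by positivity), one_div_mul_cancel hq0.ne', Real.rpow_one]
      _ < Λ ^ q := Real.rpow_lt_rpow hR.le hΛ hq0
  have hS : Summable fun k : ℕ => (2 + ((D : ℝ) + 1) * (k + 1 : ℕ)) * τ ^ (k + 1) := by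
    refine (summable_nat_add_iff (f := fun k : ℕ => (2 + ((D : ℝ) + 1) * k) * τ ^ k) 1).2 ?_
    have hτn : ‖τ‖ < 1 := by rwa [Real.norm_of_nonneg hτ0]
    have h1 := (summable_geometric_of_lt_one hτ0 hτ1).mul_left 2
    have h2 := (summable_pow_mul_geometric_of_norm_lt_one 1 hτn).mul_left ((D : ℝ) + 1)
    refine (h1.add h2).congr fun k => ?_
    ring
  set S := ∑' k : ℕ, (2 + ((D : ℝ) + 1) * (k + 1 : ℕ)) * τ ^ (k + 1)
  have hS0 : 0 ≤ S := tsum_nonneg fun k => by positivity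
  have hDθ0 : 0 < D * θ - 1 := by linarith
  set B := 2 * A * (D * θ / (D * θ - 1)) + 1 with hB
  have hB0 : 0 ≤ B := by positivity
  have hg0 : 0 ≤ g := by rw [hg]; positivity
  have hg2 : 0 < 1 - g := by linarith
  have hlam2 : 0 < 1 - lam := by linarith
  set C₁ := 1 + B + A ^ q * S
  set C₂ := A / (1 - g) + A / (1 - lam) + 1
  have hC₁ : 0 ≤ C₁ := by positivity
  have hC₂ : 0 < C₂ := by positivity
  refine ⟨C₁ + C₂, by positivity, Λ * θ, by positivity, fun f hf n K hK => ?_⟩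
  choose x hx1 hx2 using fun k => hf.exists_quantization hT hq hqp hθ hA ht hΛ0 n k
  set z := jump fun u => ⌊cellMean μ idx f n u / θ ^ n⌋ with hz
  refine ⟨fun k => x (K - 1 - k), z, ?_, ?_⟩
  · have h1 : ∑ k ∈ range K, (2 + (D + 1) * (K - k)) *
        ∑ w ∈ range (D ^ n * D ^ (K - k)), (x (K - 1 - k) w).natAbs =
        ∑ k ∈ range K, (2 + (D + 1) * (k + 1)) *
          ∑ w ∈ range (D ^ (n + k + 1)), (x k w).natAbs := by
      rw [← sum_range_reflect _ K]
      refine sum_congr rfl fun k hk => ?_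
      have hk := mem_range.1 hk
      rw [show K - (K - 1 - k) = k + 1 by omega, show K - 1 - (K - 1 - k) = k by omega, ← pow_add,
        add_assoc]
    rw [h1]
    have h2 : ((∑ k ∈ range K, (2 + (D + 1) * (k + 1)) *
        ∑ w ∈ range (D ^ (n + k + 1)), (x k w).natAbs : ℕ) : ℝ) ≤ A ^ q * S * D ^ n := by
      rw [Nat.cast_sum]
      calc _ ≤ ∑ k ∈ range K, A ^ q * D ^ n *
              ((2 + ((D : ℝ) + 1) * (k + 1 : ℕ)) * τ ^ (k + 1)) := by
            refine sum_le_sum fun k _ => ?_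
            rw [Nat.cast_mul]
            refine (mul_le_mul_of_nonneg_left (hx1 k) (by positivity)).trans_eq ?_
            push_cast
            ring
        _ ≤ A ^ q * D ^ n * S := by
            rw [← mul_sum]
            exact mul_le_mul_of_nonneg_left (hS.sum_le_tsum _ fun k _ => by positivity)
              (by positivity)
        _ = _ := by ring
    have h3 := hf.sum_natAbs_jump_floor_le hD hq hθ (by linarith) hDθ n
    rw [← hB] at h3
    rw [Nat.cast_add, Nat.cast_add, Nat.cast_pow]
    have h4 : 0 ≤ C₂ * (D : ℝ) ^ n := by positivity
    calc _ ≤ (D : ℝ) ^ n + B * D ^ n + A ^ q * S * D ^ n := by gcongr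
      _ = C₁ * D ^ n := by ring
      _ ≤ _ := by linarith
  · have h0 : (fun y => f y - (θ ^ n * ∑ u ∈ range (idx (n + K) y / D ^ K + 1), (z u : ℝ) +
          ∑ k ∈ range K, θ ^ n * (Λ * θ) ^ (K - k) * x (K - 1 - k) (idx (n + K) y / D ^ k))) =
        ((fun y => f y - cellMean μ idx f (n + K) (idx (n + K) y)) +
          ∑ k ∈ range K, fun y => cellDetail μ D idx f (n + k) (idx (n + k + 1) y) -
            θ ^ n * (Λ * θ) ^ (k + 1) * x k (idx (n + k + 1) y)) +
          fun y => cellMean μ idx f n (idx n y) -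
            θ ^ n * ⌊cellMean μ idx f n (idx n y) / θ ^ n⌋ := by
      ext y
      have h1 := cellMean_sub_cellMean hT f y (Nat.le_add_right n K)
      rw [sum_Ico_eq_sum_range, Nat.add_sub_cancel_left] at h1
      have h2 : ∑ k ∈ range K, θ ^ n * (Λ * θ) ^ (K - k) *
          x (K - 1 - k) (idx (n + K) y / D ^ k) =
          ∑ k ∈ range K, θ ^ n * (Λ * θ) ^ (k + 1) * x k (idx (n + k + 1) y) := by
        rw [← sum_range_reflect _ K]
        refine sum_congr rfl fun k hk => ?_
        have hk := mem_range.1 hk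
        rw [show K - (K - 1 - k) = k + 1 by omega, show K - 1 - (K - 1 - k) = k by omega,
          show n + K = n + k + 1 + (K - 1 - k) by omega, hT.div_pow]
      have h3 : ∑ u ∈ range (idx n y + 1), (z u : ℝ) = ⌊cellMean μ idx f n (idx n y) / θ ^ n⌋ := by
        exact_mod_cast sum_range_succ_jump _ _
      rw [h2, hT.div_pow, h3]
      simp only [Pi.add_apply, Finset.sum_apply, sum_sub_distrib]
      linarith
    have hm : ∀ (w : ℕ → ℝ) (ℓ : ℕ), AEStronglyMeasurable (fun y => w (idx ℓ y)) μ := fun w ℓ =>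
      (hT.measurable_comp w ℓ).aestronglyMeasurable
    have hm1 : AEStronglyMeasurable (fun y => f y - cellMean μ idx f (n + K) (idx (n + K) y)) μ :=
      hf.integrable.aestronglyMeasurable.sub (hm _ _)
    have hm2 : ∀ k, AEStronglyMeasurable (fun y =>
        cellDetail μ D idx f (n + k) (idx (n + k + 1) y) -
          θ ^ n * (Λ * θ) ^ (k + 1) * x k (idx (n + k + 1) y)) μ := fun k =>
      hm (fun u => cellDetail μ D idx f (n + k) u - θ ^ n * (Λ * θ) ^ (k + 1) * x k u) _
    have hm3 : AEStronglyMeasurable (fun y => cellMean μ idx f n (idx n y) -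
        θ ^ n * ⌊cellMean μ idx f n (idx n y) / θ ^ n⌋) μ :=
      hm (fun u => cellMean μ idx f n u - θ ^ n * ⌊cellMean μ idx f n u / θ ^ n⌋) _
    have e1 : eLpNorm (fun y => f y - cellMean μ idx f (n + K) (idx (n + K) y)) p μ ≤
        ENNReal.ofReal (A / (1 - g) * θ ^ n) := by
      refine (hf.eLpNorm_sub_cellMean_le hT hq hqp hθ.le (by linarith) ht hg hg1 _).trans
        (ENNReal.ofReal_le_ofReal ?_)
      rw [mul_div_assoc', div_mul_eq_mul_div]
      gcongr
    have e2 : eLpNorm (∑ k ∈ range K, fun y =>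
        cellDetail μ D idx f (n + k) (idx (n + k + 1) y) -
          θ ^ n * (Λ * θ) ^ (k + 1) * x k (idx (n + k + 1) y)) p μ ≤
        ENNReal.ofReal (A / (1 - lam) * θ ^ n) := by
      refine (eLpNorm_sum_le (fun k _ => hm2 k) hp1).trans ?_
      refine (sum_le_sum fun k _ => hx2 k).trans ?_
      rw [← ENNReal.ofReal_sum_of_nonneg fun k _ => by positivity, ← mul_sum]
      refine ENNReal.ofReal_le_ofReal ?_
      have h1 : ∑ k ∈ range K, lam ^ (k + 1) ≤ 1 / (1 - lam) := by
        simp only [pow_succ]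
        rw [← sum_mul, range_eq_Ico]
        refine (mul_le_mul_of_nonneg_right (geom_sum_Ico_le hlam0.le hΛ1 0 K) hlam0.le).trans ?_
        rw [pow_zero]
        exact mul_le_of_le_one_right (by positivity) hΛ1.le
      refine (mul_le_mul_of_nonneg_left h1 (by positivity)).trans_eq ?_
      ring
    have e3 : eLpNorm (fun y => cellMean μ idx f n (idx n y) -
        θ ^ n * ⌊cellMean μ idx f n (idx n y) / θ ^ n⌋) p μ ≤ ENNReal.ofReal (θ ^ n) := by
      refine (eLpNorm_le_of_ae_bound (C := θ ^ n) (.of_forall fun y => ?_)).trans_eq (by simp)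
      have h1 : cellMean μ idx f n (idx n y) = θ ^ n * (cellMean μ idx f n (idx n y) / θ ^ n) := by
        field_simp
      nth_rw 1 [h1]
      rw [← mul_sub, Int.self_sub_floor, Real.norm_of_nonneg (by positivity)]
      exact mul_le_of_le_one_right (by positivity) (Int.fract_lt_one _).le
    rw [h0]
    refine (eLpNorm_add_le (hm1.add (aestronglyMeasurable_sum _ fun k _ => hm2 k)) hm3 hp1).trans ?_
    refine (add_le_add ((eLpNorm_add_le hm1 (aestronglyMeasurable_sum _ fun k _ => hm2 k)
      hp1).trans (add_le_add e1 e2)) e3).trans ?_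
    rw [← ENNReal.ofReal_add (by positivity) (by positivity),
      ← ENNReal.ofReal_add (by positivity) (by positivity)]
    refine ENNReal.ofReal_le_ofReal ?_
    have h4 : 0 ≤ C₁ * θ ^ n := by positivity
    calc _ = C₂ * θ ^ n := by ring
      _ ≤ _ := by linarith

end

section

variable {X : Type*} [MeasurableSpace X] {μ : Measure X} {D : ℕ} {idx : ℕ → X → ℕ}

lemma TreeSmooth.of_lintegral_le [IsProbabilityMeasure μ] (hT : TreePartition D μ idx)
    {q θ A : ℝ} {f : X → ℝ} (hf : Integrable f μ) (hq : 1 ≤ q) (hθ : 0 ≤ θ) (hθ1 : θ < 1)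
    (hA : 0 ≤ A) (hmean : |cellMean μ idx f 0 0| ≤ A)
    (hE : ∀ ℓ, ∫⁻ x, ‖f x - cellMean μ idx f ℓ (idx ℓ x)‖ₑ ^ q ∂μ ≤
      ENNReal.ofReal ((A * θ ^ (ℓ + 1)) ^ q)) : TreeSmooth D μ idx q θ A f where
  integrable := hf
  mean := hmean
  detail ℓ := by
    have h1 := (hT.sum_enorm_cellDetail_le hf hq ℓ).trans (mul_le_mul_right (hE ℓ) _)
    simp only [Real.enorm_eq_ofReal_abs] at h1
    simp only [ENNReal.ofReal_rpow_of_nonneg (abs_nonneg _) (zero_le_one.trans hq)] at h1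
    rw [← ENNReal.ofReal_sum_of_nonneg fun u _ => by positivity, ← ENNReal.ofReal_natCast,
      ← ENNReal.ofReal_pow (by positivity), ← ENNReal.ofReal_mul (by positivity)] at h1
    exact (ENNReal.ofReal_le_ofReal_iff (by positivity)).1 h1
  tendsto := by
    have hq0 : 0 < q := by linarith
    have h1 : ∀ ℓ, eLpNorm (fun x => cellMean μ idx f ℓ (idx ℓ x) - f x) (ENNReal.ofReal q) μ ≤
        ENNReal.ofReal (A * θ ^ (ℓ + 1)) := by
      intro ℓ
      rw [eLpNorm_eq_lintegral_rpow_enorm_toReal (by simpa using hq0) (by simp),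
        ENNReal.toReal_ofReal hq0.le, one_div, ENNReal.rpow_inv_le_iff hq0,
        ENNReal.ofReal_rpow_of_nonneg (by positivity) hq0.le]
      simpa only [← enorm_neg (f _ - _), neg_sub] using hE ℓ
    refine tendsto_of_tendsto_of_tendsto_of_le_of_le tendsto_const_nhds ?_ (fun _ => zero_le) h1
    have h2 : Filter.Tendsto (fun ℓ : ℕ => A * θ ^ (ℓ + 1)) Filter.atTop (nhds (A * 0)) :=
      ((tendsto_pow_atTop_nhds_zero_of_lt_one hθ hθ1).comp (Filter.tendsto_add_atTop_nat 1)).const_mul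
        A
    simpa using ENNReal.tendsto_ofReal h2

end

section Morton

variable {d b : ℕ}

/-- The combination of the lowest base-`b` digits in a Morton index. -/
def mortonDigit (hb : 0 < b) (n : Fin d → ℕ) : Fin (b ^ d) :=
  finFunctionFinEquiv fun j => ⟨n j % b, Nat.mod_lt _ hb⟩

lemma morton_succ (hb : 0 < b) (ℓ : ℕ) (n : Fin d → ℕ) :
    morton b d (ℓ + 1) n = b ^ d * morton b d ℓ (fun j => n j / b) + mortonDigit hb n := by
  rw [mortonDigit, finFunctionFinEquiv_apply, morton, morton, mul_sum, ← sum_add_distrib]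
  refine sum_congr rfl fun j _ => ?_
  rw [spread]
  ring

lemma morton_lt (hb : 0 < b) (ℓ : ℕ) (n : Fin d → ℕ) : morton b d ℓ n < (b ^ d) ^ ℓ := by
  induction ℓ generalizing n with
  | zero => simp [morton, spread]
  | succ ℓ ih =>
    rw [morton_succ hb, pow_succ']
    calc _ < b ^ d * (morton b d ℓ (fun j => n j / b) + 1) := by
          rw [mul_add_one]; exact Nat.add_lt_add_left (mortonDigit hb n).2 _
      _ ≤ _ := Nat.mul_le_mul_left _ (ih _)

lemma morton_succ_div (hb : 0 < b) (ℓ : ℕ) (n : Fin d → ℕ) :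
    morton b d (ℓ + 1) n / b ^ d = morton b d ℓ fun j => n j / b := by
  rw [morton_succ hb, Nat.mul_add_div (by positivity), Nat.div_eq_of_lt (mortonDigit hb n).2,
    add_zero]

lemma morton_injective (hb : 0 < b) {ℓ : ℕ} {n m : Fin d → ℕ} (hn : ∀ j, n j < b ^ ℓ)
    (hm : ∀ j, m j < b ^ ℓ) (h : morton b d ℓ n = morton b d ℓ m) : n = m := by
  induction ℓ generalizing n m with
  | zero =>
    ext j
    have h1 := hn j
    have h2 := hm j
    simp only [pow_zero] at h1 h2
    omega
  | succ ℓ ih =>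
    have h1 : (fun j => n j / b) = fun j => m j / b := by
      refine ih (fun j => Nat.div_lt_of_lt_mul ?_) (fun j => Nat.div_lt_of_lt_mul ?_) ?_
      · rw [← pow_succ']; exact hn j
      · rw [← pow_succ']; exact hm j
      · rw [← morton_succ_div hb, ← morton_succ_div hb, h]
    rw [morton_succ hb, morton_succ hb, h1, Nat.add_left_cancel_iff, Fin.val_inj, mortonDigit,
      mortonDigit, finFunctionFinEquiv.injective.eq_iff] at h
    ext j
    have h2 := congrFun h1 j
    have h3 := congrArg Fin.val (congrFun h j)
    simp only at h2 h3
    rw [← Nat.div_add_mod (n j) b, ← Nat.div_add_mod (m j) b, h2, h3]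

lemma exists_morton_eq (hb : 0 < b) {ℓ u : ℕ} (hu : u < (b ^ d) ^ ℓ) :
    ∃ n : Fin d → ℕ, (∀ j, n j < b ^ ℓ) ∧ morton b d ℓ n = u := by
  induction ℓ generalizing u with
  | zero => exact ⟨0, by simp, by simp at hu; simp [hu, morton, spread]⟩
  | succ ℓ ih =>
    have hD : 0 < b ^ d := by positivity
    obtain ⟨n, hn, h⟩ := ih (u := u / b ^ d)
      (Nat.div_lt_of_lt_mul (by rw [← pow_succ']; exact hu))
    let e := finFunctionFinEquiv.symm (⟨u % b ^ d, Nat.mod_lt _ hD⟩ : Fin (b ^ d))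
    have h1 : ∀ j, (b * n j + e j) / b = n j := fun j => by
      rw [Nat.mul_add_div hb, Nat.div_eq_of_lt (e j).2, add_zero]
    have h2 : ∀ j, (b * n j + e j) % b = e j := fun j => by
      rw [Nat.mul_add_mod, Nat.mod_eq_of_lt (e j).2]
    refine ⟨fun j => b * n j + e j, fun j => ?_, ?_⟩
    · calc _ < b * (n j + 1) := by
            rw [mul_add_one]; exact Nat.add_lt_add_left (e j).2 _
        _ ≤ _ := by rw [pow_succ']; exact Nat.mul_le_mul_left _ (hn j)
    · rw [morton_succ hb]
      have h3 : mortonDigit hb (fun j => b * n j + (e j : ℕ)) = finFunctionFinEquiv e := by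
        rw [mortonDigit]
        congr 1
        ext j
        exact h2 j
      rw [h3, Equiv.apply_symm_apply]
      simp only [h1, h]
      exact Nat.div_add_mod u _

end Morton

section Cube

variable (d : ℕ)

/-- The half-open unit cube. -/
def halfOpenCube : Set (Fin d → ℝ) := Set.univ.pi fun _ => Set.Ico 0 1

/-- Lebesgue measure on the half-open unit cube. -/
def cubeMeasure : Measure (Fin d → ℝ) := volume.restrict (halfOpenCube d)

/-- The Morton index of the dyadic cube of level `ℓ` containing a point. -/
def cubeIndex (b ℓ : ℕ) (x : Fin d → ℝ) : ℕ := morton b d ℓ (gridPoint b ℓ x)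

variable {d}

lemma measurableSet_halfOpenCube : MeasurableSet (halfOpenCube d) :=
  .univ_pi fun _ => measurableSet_Ico

lemma halfOpenCube_subset : halfOpenCube d ⊆ unitCube d := fun _ hx =>
  ⟨fun j => (hx j trivial).1, fun j => (hx j trivial).2.le⟩

instance : IsProbabilityMeasure (cubeMeasure d) :=
  ⟨by simp [cubeMeasure, halfOpenCube, volume_pi_pi]⟩

lemma gridPoint_lt {b ℓ : ℕ} (hb : 0 < b) {x : Fin d → ℝ} (hx : x ∈ halfOpenCube d) (j : Fin d) :
    gridPoint b ℓ x j < b ^ ℓ := by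
  have h := hx j trivial
  rw [gridPoint, Nat.floor_lt' (by positivity)]
  push_cast
  exact mul_lt_of_lt_one_right (by positivity) h.2

lemma measurable_cubeIndex (b ℓ : ℕ) : Measurable (cubeIndex d b ℓ) :=
  (measurable_of_countable (morton b d ℓ)).comp <| measurable_pi_lambda _ fun j =>
    Nat.measurable_floor.comp ((measurable_pi_apply j).const_mul _)

lemma cubeIndex_eq_iff {b ℓ : ℕ} (hb : 0 < b) {x y : Fin d → ℝ} (hx : x ∈ halfOpenCube d)
    (hy : y ∈ halfOpenCube d) :
    cubeIndex d b ℓ x = cubeIndex d b ℓ y ↔ gridPoint b ℓ x = gridPoint b ℓ y :=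
  ⟨morton_injective hb (gridPoint_lt hb hx) (gridPoint_lt hb hy), congrArg _⟩

lemma gridPoint_eq_iff {b ℓ : ℕ} (hb : 0 < b) {x : Fin d → ℝ} (hx : 0 ≤ x) (n : Fin d → ℕ) :
    gridPoint b ℓ x = n ↔
      ∀ j, x j ∈ Set.Ico ((n j : ℝ) / (b : ℝ) ^ ℓ) ((n j + 1) / (b : ℝ) ^ ℓ) := by
  rw [funext_iff]
  refine forall_congr' fun j => ?_
  have hB : (0 : ℝ) < (b : ℝ) ^ ℓ := by positivity
  rw [gridPoint, Nat.floor_eq_iff (mul_nonneg hB.le (hx j)), Set.mem_Ico, div_le_iff₀ hB,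
    lt_div_iff₀ hB, mul_comm]

lemma treePartition_cube {b : ℕ} (hb : 0 < b) :
    TreePartition (b ^ d) (cubeMeasure d) (cubeIndex d b) where
  measurable ℓ := measurable_cubeIndex b ℓ
  lt ℓ x := morton_lt hb ℓ _
  div ℓ x := by
    rw [cubeIndex, morton_succ_div hb, cubeIndex]
    congr 1
    ext j
    simpa using gridPoint_div b ℓ 1 hb x j
  measure ℓ u hu := by
    obtain ⟨n, hn, rfl⟩ := exists_morton_eq hb hu
    have hB : (0 : ℝ) < (b : ℝ) ^ ℓ := by positivity
    have h1 : cubeIndex d b ℓ ⁻¹' {morton b d ℓ n} ∩ halfOpenCube d =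
        Set.univ.pi fun j => Set.Ico ((n j : ℝ) / (b : ℝ) ^ ℓ) ((n j + 1) / (b : ℝ) ^ ℓ) := by
      ext x
      constructor
      · rintro ⟨h, hx⟩ j -
        exact (gridPoint_eq_iff hb (fun j => (hx j trivial).1) n).1
          (morton_injective hb (gridPoint_lt hb hx) hn h) j
      · intro h
        have hx : x ∈ halfOpenCube d := by
          intro j _
          have h2 := h j trivial
          have h3 : ((n j + 1 : ℕ) : ℝ) ≤ ((b ^ ℓ : ℕ) : ℝ) := Nat.cast_le.2 (hn j)
          push_cast at h3
          refine ⟨le_trans (by positivity) h2.1, h2.2.trans_le ?_⟩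
          rwa [div_le_one hB]
        refine ⟨?_, hx⟩
        have := (gridPoint_eq_iff hb (fun j => (hx j trivial).1) n).2 fun j => h j trivial
        simp [cubeIndex, this]
    rw [cubeMeasure, Measure.restrict_apply (measurable_cubeIndex b ℓ (measurableSet_singleton _)),
      h1, volume_pi_pi]
    have h2 : ∀ j, volume (Set.Ico ((n j : ℝ) / (b : ℝ) ^ ℓ) ((n j + 1) / (b : ℝ) ^ ℓ)) =
        ((b : ℝ≥0∞) ^ ℓ)⁻¹ := by
      intro j
      rw [Real.volume_Ico, ← sub_div, add_sub_cancel_left, one_div, ENNReal.ofReal_inv_of_pos hB,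
        ENNReal.ofReal_pow (by positivity), ENNReal.ofReal_natCast]
    simp only [h2, prod_const, card_univ, Fintype.card_fin]
    rw [Nat.cast_pow, ← ENNReal.inv_pow, ← pow_mul, ← pow_mul, mul_comm]

lemma sqrt_sum_sq_sub_le {b ℓ : ℕ} (hb : 0 < b) {x y : Fin d → ℝ} (hx : x ∈ halfOpenCube d)
    (hy : y ∈ halfOpenCube d) (h : cubeIndex d b ℓ x = cubeIndex d b ℓ y) :
    √(∑ j, (x j - y j) ^ 2) ≤ √d / (b : ℝ) ^ ℓ := by
  have hB : (0 : ℝ) < (b : ℝ) ^ ℓ := by positivity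
  have h1 := (gridPoint_eq_iff hb (fun j => (hx j trivial).1) (gridPoint b ℓ x)).1 rfl
  have h2 := (gridPoint_eq_iff hb (fun j => (hy j trivial).1) (gridPoint b ℓ x)).1
    ((cubeIndex_eq_iff hb hx hy).1 h).symm
  have h3 : ∀ j, (x j - y j) ^ 2 ≤ (1 / (b : ℝ) ^ ℓ) ^ 2 := by
    intro j
    obtain ⟨h4, h5⟩ := h1 j
    obtain ⟨h6, h7⟩ := h2 j
    rw [add_div] at h5 h7
    exact sq_le_sq' (by linarith) (by linarith)
  rw [Real.sqrt_le_left (by positivity), div_pow, Real.sq_sqrt (by positivity)]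
  refine (sum_le_sum fun j _ => h3 j).trans_eq ?_
  simp [div_eq_mul_inv]

end Cube

section Sobolev

variable {d b : ℕ} {s q : ℝ} {f : (Fin d → ℝ) → ℝ}

/-- The Gagliardo seminorm controls the oscillation of a function on cells of small diameter. -/
lemma lintegral_cell_sub_le (hb : 0 < b) (hs : 0 < s) (hq : 1 ≤ q)
    (hf : ∫⁻ x in unitCube d, ∫⁻ y in unitCube d, ENNReal.ofReal (|f x - f y| ^ q /
      √(∑ j, (x j - y j) ^ 2) ^ ((d : ℝ) + s * q)) ≤ 1) (ℓ : ℕ) :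
    ∫⁻ x, ∫⁻ y in cubeIndex d b ℓ ⁻¹' {cubeIndex d b ℓ x}, ‖f x - f y‖ₑ ^ q ∂cubeMeasure d
      ∂cubeMeasure d ≤ ENNReal.ofReal ((√d / (b : ℝ) ^ ℓ) ^ ((d : ℝ) + s * q)) := by
  have hq0 : 0 < q := by linarith
  have he : 0 < (d : ℝ) + s * q := by positivity
  set M := ENNReal.ofReal ((√d / (b : ℝ) ^ ℓ) ^ ((d : ℝ) + s * q)) with hM
  set k : (Fin d → ℝ) → (Fin d → ℝ) → ℝ≥0∞ := fun x y => ENNReal.ofReal (|f x - f y| ^ q /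
      √(∑ j, (x j - y j) ^ 2) ^ ((d : ℝ) + s * q)) with hk
  have hpt : ∀ x ∈ halfOpenCube d, ∀ y ∈ halfOpenCube d,
      cubeIndex d b ℓ x = cubeIndex d b ℓ y → ‖f x - f y‖ₑ ^ q ≤ M * k x y := by
    intro x hx y hy h
    have h1 := sqrt_sum_sq_sub_le hb hx hy h
    rw [hM, hk, ← ENNReal.ofReal_mul (by positivity), Real.enorm_eq_ofReal_abs,
      ENNReal.ofReal_rpow_of_nonneg (abs_nonneg _) hq0.le]
    refine ENNReal.ofReal_le_ofReal ?_
    rcases (Real.sqrt_nonneg (∑ j, (x j - y j) ^ 2)).eq_or_lt with h0 | h0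
    · have h2 : x = y := by
        have h3 := (Real.sqrt_eq_zero (sum_nonneg fun j _ => sq_nonneg _)).1 h0.symm
        rw [sum_eq_zero_iff_of_nonneg fun j _ => sq_nonneg _] at h3
        ext j
        exact sub_eq_zero.1 (pow_eq_zero_iff two_ne_zero |>.1 (h3 j (mem_univ j)))
      rw [h2, sub_self, abs_zero, Real.zero_rpow hq0.ne', _root_.zero_div, mul_zero]
    · rw [mul_div_left_comm]
      refine le_mul_of_one_le_right (by positivity) ?_
      rw [one_le_div (by positivity)]
      exact Real.rpow_le_rpow h0.le h1 he.le
  have h1 : ∀ᵐ x ∂cubeMeasure d,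
      ∫⁻ y in cubeIndex d b ℓ ⁻¹' {cubeIndex d b ℓ x}, ‖f x - f y‖ₑ ^ q ∂cubeMeasure d ≤
        M * ∫⁻ y in unitCube d, k x y := by
    filter_upwards [ae_restrict_mem measurableSet_halfOpenCube] with x hx
    rw [← lintegral_const_mul' _ _ ENNReal.ofReal_ne_top]
    have h2 : MeasurableSet (cubeIndex d b ℓ ⁻¹' {cubeIndex d b ℓ x}) :=
      measurable_cubeIndex b ℓ (measurableSet_singleton _)
    rw [cubeMeasure, Measure.restrict_restrict h2]
    refine (setLIntegral_mono_ae' (h2.inter measurableSet_halfOpenCube)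
      (.of_forall fun y hy => hpt x hx y hy.2 (Eq.symm hy.1))).trans ?_
    exact lintegral_mono_set (Set.inter_subset_right.trans halfOpenCube_subset)
  refine (lintegral_mono_ae h1).trans ?_
  rw [lintegral_const_mul' _ _ ENNReal.ofReal_ne_top]
  refine mul_le_of_le_one_right zero_le ((lintegral_mono_set halfOpenCube_subset).trans hf)

theorem exists_treeSmooth_of_sobNorm_le (hd : 0 < d) (hb : 2 ≤ b) (hs : 0 < s) (hq : 1 ≤ q) :
    ∃ A : ℝ, 1 ≤ A ∧ ∀ f : (Fin d → ℝ) → ℝ, Measurable f → sobNorm d s q f ≤ 1 →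
      TreeSmooth (b ^ d) (cubeMeasure d) (cubeIndex d b) q ((b : ℝ) ^ (-s)) A f := by
  have hq0 : 0 < q := by linarith
  have hb0 : 0 < b := by omega
  have hb1 : (1 : ℝ) < b := by exact_mod_cast hb
  have hT := treePartition_cube (d := d) hb0
  set θ := (b : ℝ) ^ (-s) with hθ
  have hθ0 : 0 < θ := by positivity
  have hθ1 : θ < 1 := Real.rpow_lt_one_of_one_lt_of_neg hb1 (by linarith)
  set B := √d ^ ((d : ℝ) + s * q) with hB
  have hB1 : 1 ≤ B := by
    refine Real.one_le_rpow ?_ (by positivity)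
    rw [Real.one_le_sqrt]
    exact_mod_cast hd
  have hA : 1 ≤ B ^ (1 / q) / θ := by
    rw [one_le_div hθ0]
    exact hθ1.le.trans (Real.one_le_rpow hB1 (by positivity))
  refine ⟨B ^ (1 / q) / θ, hA, fun f hf hnorm => ?_⟩
  have hsum := hnorm
  rw [sobNorm, one_div, ENNReal.rpow_inv_le_iff hq0, ENNReal.one_rpow] at hsum
  have hLq : ∫⁻ x, ‖f x‖ₑ ^ q ∂cubeMeasure d ≤ 1 := by
    refine le_trans ?_ ((le_add_right le_rfl).trans hsum)
    refine (lintegral_mono_set halfOpenCube_subset).trans (lintegral_mono fun x => ?_)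
    rw [Real.enorm_eq_ofReal_abs, ENNReal.ofReal_rpow_of_nonneg (abs_nonneg _) hq0.le]
  have hint : Integrable f (cubeMeasure d) := by
    have : MemLp f (ENNReal.ofReal q) (cubeMeasure d) := by
      refine ⟨hf.aestronglyMeasurable, ?_⟩
      rw [eLpNorm_eq_lintegral_rpow_enorm_toReal (by simpa using hq0) (by simp),
        ENNReal.toReal_ofReal hq0.le]
      exact ENNReal.rpow_lt_top_of_nonneg (by positivity) (hLq.trans_lt ENNReal.one_lt_top).ne
    exact this.integrable (by simpa using ENNReal.ofReal_le_ofReal hq)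
  refine TreeSmooth.of_lintegral_le hT hint hq hθ0.le hθ1 (by positivity) ?_ fun ℓ => ?_
  · have h0 : 0 < (b ^ d) ^ 0 := by simp
    have := hT.isProbabilityMeasure_cond h0
    have h1 := enorm_sub_integral_rpow_le (hT.integrable_cond hint h0) hq 0
    rw [hT.lintegral_cond h0, pow_zero, one_mul] at h1
    simp only [zero_sub, enorm_neg] at h1
    have h2 : ‖cellMean (cubeMeasure d) (cubeIndex d b) f 0 0‖ₑ ^ q ≤ 1 :=
      h1.trans ((setLIntegral_le_lintegral _ _).trans hLq)
    rw [Real.enorm_eq_ofReal_abs, ENNReal.ofReal_rpow_of_nonneg (abs_nonneg _) hq0.le,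
      ENNReal.ofReal_le_one, ← Real.one_rpow q,
      Real.rpow_le_rpow_iff (abs_nonneg _) zero_le_one hq0] at h2
    exact h2.trans hA
  · refine (hT.lintegral_enorm_sub_cellMean_le hint hq ℓ).trans ?_
    refine (mul_le_mul_right (lintegral_cell_sub_le hb0 hs hq
      ((le_add_left le_rfl).trans hsum) ℓ) _).trans_eq ?_
    rw [← ENNReal.ofReal_natCast, ← ENNReal.ofReal_pow (by positivity),
      ← ENNReal.ofReal_mul (by positivity)]
    congr 1
    rw [pow_succ θ, mul_comm (θ ^ ℓ), ← mul_assoc, div_mul_cancel₀ _ hθ0.ne',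
      Real.mul_rpow (by positivity) (by positivity), ← Real.rpow_mul (by positivity),
      one_div_mul_cancel hq0.ne', Real.rpow_one, Real.div_rpow (by positivity) (by positivity),
      ← hB, mul_div_left_comm]
    congr 1
    have hb' : (0 : ℝ) < b := by positivity
    rw [Nat.cast_pow, hθ, ← Real.rpow_natCast, ← Real.rpow_natCast, ← Real.rpow_natCast,
      ← Real.rpow_natCast, ← Real.rpow_mul hb'.le, ← Real.rpow_mul hb'.le, ← Real.rpow_mul hb'.le,
      ← Real.rpow_mul hb'.le, ← Real.rpow_sub hb']
    congr 1
    ring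

end Sobolev

section GoodRegion

variable {d b ℓ : ℕ} {ε : ℝ}

lemma measurableSet_goodRegion : MeasurableSet (goodRegion d b ℓ ε) := by
  refine MeasurableSet.biUnion (Set.to_countable _) fun i _ => ?_
  rw [trimmedCell, Set.ofPred_forall]
  refine MeasurableSet.iInter fun j => ?_
  split_ifs
  · exact (measurableSet_le measurable_const (measurable_pi_apply j)).inter
      (measurableSet_lt (measurable_pi_apply j) measurable_const)
  · exact (measurableSet_le measurable_const (measurable_pi_apply j)).inter
      (measurableSet_lt (measurable_pi_apply j) measurable_const)

lemma exists_of_mem_goodRegion (hb : 0 < b) {x : Fin d → ℝ} (hx : x ∈ goodRegion d b ℓ ε)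
    (j : Fin d) : ∃ n < b ^ ℓ, (n : ℝ) / (b : ℝ) ^ ℓ ≤ x j ∧
      (n + 1 < b ^ ℓ ∧ x j < ((n : ℝ) + 1) / (b : ℝ) ^ ℓ - ε ∨ n + 1 = b ^ ℓ ∧ x j < 1) := by
  simp only [goodRegion, Set.mem_iUnion, Set.mem_ofPred_eq, trimmedCell] at hx
  obtain ⟨i, hi, hx⟩ := hx
  have h1 := hx j
  have h2 := hi j
  refine ⟨i j, h2, ?_⟩
  split_ifs at h1 with h
  · exact ⟨h1.1, .inl ⟨by omega, h1.2⟩⟩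
  · have h3 : i j + 1 = b ^ ℓ := by omega
    refine ⟨le_trans (le_of_eq ?_) h1.1, .inr ⟨h3, h1.2⟩⟩
    have h4 : (i j : ℝ) + 1 = (b : ℝ) ^ ℓ := by exact_mod_cast h3
    have h5 : (b : ℝ) ^ ℓ ≠ 0 := by positivity
    rw [← h4] at h5 ⊢
    field_simp
    ring

lemma goodCoordinates_goodRegion (hb : 0 < b) (hε : 0 < ε) :
    GoodCoordinates b ℓ ε fun (j : Fin d) (x : goodRegion d b ℓ ε) => x.1 j := by
  have hB : (0 : ℝ) < (b : ℝ) ^ ℓ := by positivity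
  refine ⟨fun j x => ?_, fun j x => ?_, fun j x ρ m hρ hm hlt => ?_⟩ <;>
    obtain ⟨n, hn, h1, h2⟩ := exists_of_mem_goodRegion hb x.2 j
  · exact le_trans (by positivity) h1
  · rcases h2 with ⟨h2, h3⟩ | ⟨-, h3⟩
    · have h4 : ((n : ℝ) + 1) / (b : ℝ) ^ ℓ ≤ 1 := by
        rw [div_le_one hB]; exact_mod_cast h2.le
      linarith
    · exact h3
  · have h3 : (m : ℝ) / (b : ℝ) ^ ρ = (m * b ^ (ℓ - ρ) : ℕ) / (b : ℝ) ^ ℓ := by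
      have h5 : (b : ℝ) ^ ℓ = (b : ℝ) ^ ρ * (b : ℝ) ^ (ℓ - ρ) := by rw [← pow_add]; congr; omega
      have h6 : (b : ℝ) ^ (ℓ - ρ) ≠ 0 := by positivity
      push_cast
      rw [h5, mul_div_mul_right _ _ h6]
    have h4 : n + 1 ≤ m * b ^ (ℓ - ρ) := by
      have h5 := h1.trans_lt (hlt.trans_eq h3)
      rw [div_lt_div_iff_of_pos_right hB] at h5
      exact_mod_cast h5
    have h5 : m * b ^ (ℓ - ρ) < b ^ ℓ := by
      calc _ < b ^ ρ * b ^ (ℓ - ρ) := Nat.mul_lt_mul_of_pos_right hm (by positivity)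
        _ = b ^ ℓ := by rw [← pow_add]; congr; omega
    rcases h2 with ⟨-, h2⟩ | ⟨h2, -⟩
    · have h6 : ((n : ℝ) + 1) / (b : ℝ) ^ ℓ ≤ (m * b ^ (ℓ - ρ) : ℕ) / (b : ℝ) ^ ℓ := by
        gcongr; exact_mod_cast h4
      rw [h3]
      linarith
    · omega

lemma goodRegion_subset (hb : 0 < b) (hε : 0 < ε) : goodRegion d b ℓ ε ⊆ halfOpenCube d :=
  fun x hx j _ => ⟨(goodCoordinates_goodRegion hb hε).nonneg j ⟨x, hx⟩,
    (goodCoordinates_goodRegion hb hε).lt_one j ⟨x, hx⟩⟩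

/-- Evaluation of a quantized multiscale expansion by a network on the good region. -/
lemma exists_network_forest (hd : 0 < d) (hb : 0 < b) (hε : 0 < ε) {α β n K c r : ℕ}
    (hn : n = 2 * (α + β)) (hℓ : ℓ = n + K) (hr : ℓ ≤ r * α) {ρ : ℝ} (hρ : ρ ≠ 0) (δ : ℝ)
    {y : ℕ → ℕ → ℤ} {z : ℕ → ℤ}
    (hc : (b ^ d) ^ n + ∑ u ∈ range ((b ^ d) ^ n), (z u).natAbs +
      ∑ k ∈ range K, (2 + (b ^ d + 1) * (K - k)) *
        ∑ w ∈ range ((b ^ d) ^ n * (b ^ d) ^ (K - k)), (y k w).natAbs ≤ c * (b ^ d) ^ n) :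
    ∃ g ∈ NN d 1 ((6 * d + 80) * b ^ (d * α)) (r + 27 * b ^ (d * β) + 3 * (c * b ^ (d * β))),
      ∀ x ∈ goodRegion d b ℓ ε, g x 0 =
        δ * ∑ u ∈ range (cubeIndex d b ℓ x / (b ^ d) ^ K + 1), (z u : ℝ) +
          ∑ k ∈ range K, δ * ρ ^ (K - k) * y k (cubeIndex d b ℓ x / (b ^ d) ^ k) := by
  have hD : 0 < b ^ d := by positivity
  have hM : 0 < b ^ (d * α) := by positivity
  have hbM : b ^ α ≤ b ^ (d * α) := Nat.pow_le_pow_right hb (Nat.le_mul_of_pos_left _ hd)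
  have hlt : ∀ x : goodRegion d b ℓ ε, cubeIndex d b ℓ x.1 < (b ^ d) ^ n * (b ^ d) ^ K :=
    fun x => by rw [← pow_add, ← hℓ]; exact morton_lt hb _ _
  have h1 := Computes.morton (W := (6 * d + 80) * b ^ (d * α))
    (goodCoordinates_goodRegion (d := d) (ℓ := ℓ) hb hε) hb hε (by nlinarith) hr
  have h2 := Computes.program hlt h1 (treeMatrix (b ^ d : ℕ) ρ) 0
    (treeMatrix_clockMonotone (D := b ^ d) (ρ := ρ))
    (x₀ := ![0, 0, ((b ^ d : ℕ) : ℝ) ^ K, δ]) (by simp) (by simp)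
    (r := b ^ (d * β)) (M := b ^ (d * α)) (m := c * b ^ (d * β)) (by positivity) hM
    (forestProgram (b ^ d) y z K ((b ^ d) ^ n))
    ((length_forestProgram_le _ _ _).trans (hc.trans_eq (by rw [hn]; ring)))
    (by simp only [Fintype.card_fin]; nlinarith) 1
  obtain ⟨g, hg, hgx⟩ := h2.exists_network ()
  refine ⟨g, ?_, fun x hx => ?_⟩
  · convert hg using 2
    simp only [Fintype.card_fin]
    ring
  · rw [hgx ⟨x, hx⟩, runStop_forestProgram hD hρ (hlt ⟨x, hx⟩)]

end GoodRegion

theorem sobolev_approx_good_region (d b : ℕ) (hd : 1 ≤ d) (hb : 2 ≤ b)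
    (s q : ℝ) (p : ℝ≥0∞) (hs0 : 0 < s) (hs1 : s < 1) (hq : 1 ≤ q)
    (hqp : ENNReal.ofReal q ≤ p)
    (hemb : 1 / q - 1 / p.toReal < s / d) :
    ∃ C : ℝ, 0 < C ∧
      ∀ α β : ℕ, 1 ≤ α → 1 ≤ β →
      ∀ lstar : ℕ,
        lstar = ⌊2 * (s / (s + (d : ℝ) / p.toReal - (d : ℝ) / q)) * ((α : ℝ) + β)⌋₊ →
      ∀ ε : ℝ, 0 < ε → ε < (b : ℝ) ^ (-(lstar : ℤ)) →
      ∀ f : (Fin d → ℝ) → ℝ, Measurable f → sobNorm d s q f ≤ 1 →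
        ∃ W L : ℕ, 1 ≤ W ∧ 1 ≤ L ∧
          (W : ℝ) ≤ C * (b : ℝ) ^ (d * α) ∧ (L : ℝ) ≤ C * (b : ℝ) ^ (d * β) ∧
          ∃ g ∈ NN d 1 W L,
            eLpNorm (fun x => f x - g x 0) p
                (volume.restrict (goodRegion d b lstar ε)) ≤
              ENNReal.ofReal (C * (b : ℝ) ^ (-(2 * s) * ((α : ℝ) + β))) := by
  have hq0 : 0 < q := by linarith
  have hb0 : 0 < b := by omega
  have hd0 : (0 : ℝ) < d := by exact_mod_cast hd
  have hb1 : (1 : ℝ) < b := by exact_mod_cast hb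
  have hb' : (0 : ℝ) < b := by positivity
  have ht : q / p.toReal ≤ 1 := by
    rcases eq_or_ne p ∞ with rfl | hp
    · simp
    · have h1 := (ENNReal.ofReal_le_iff_le_toReal hp).1 hqp
      exact (div_le_one (hq0.trans_le h1)).2 h1
  have hdp : (d : ℝ) / p.toReal = d / q * (q / p.toReal) := by
    rw [div_mul_div_cancel₀ hq0.ne']
  set γ := s + (d : ℝ) / p.toReal - (d : ℝ) / q with hγ
  have hγ0 : 0 < γ := by
    have h1 := mul_lt_mul_of_pos_left hemb hd0
    rw [mul_div_cancel₀ _ hd0.ne', mul_sub, mul_one_div, mul_one_div] at h1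
    linarith
  have hγs : γ ≤ s := by
    have : d / q * (q / p.toReal) ≤ (d : ℝ) / q := mul_le_of_le_one_right (by positivity) ht
    linarith
  set κ := s / γ with hκ
  have hκ1 : 1 ≤ κ := (one_le_div hγ0).2 hγs
  have hκγ : γ * κ = s := mul_div_cancel₀ _ hγ0.ne'
  set θ := (b : ℝ) ^ (-s) with hθ
  have hθ0 : 0 < θ := by positivity
  obtain ⟨A, hA, hsmooth⟩ := exists_treeSmooth_of_sobNorm_le (d := d) hd hb hs0 hq
  have hDθ : 1 < ((b ^ d : ℕ) : ℝ) * θ := by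
    rw [Nat.cast_pow, hθ, ← Real.rpow_natCast, ← Real.rpow_add hb']
    refine Real.one_lt_rpow hb1 ?_
    have : (1 : ℝ) ≤ d := by exact_mod_cast hd
    linarith
  have hg : (b : ℝ) ^ (-γ) = (((b ^ d : ℕ) : ℝ) ^ (1 / q) * θ) ^ (1 - q / p.toReal) *
      θ ^ (q / p.toReal) := by
    rw [Nat.cast_pow, hθ, ← Real.rpow_natCast, ← Real.rpow_mul hb'.le, ← Real.rpow_add hb',
      ← Real.rpow_mul hb'.le, ← Real.rpow_mul hb'.le, ← Real.rpow_add hb', hγ, hdp]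
    congr 1
    ring
  obtain ⟨C₀, hC₀, ρ, hρ, happrox⟩ := (treePartition_cube (d := d) hb0).exists_forest_approx
    (by positivity) hq hqp hθ0 hA ht hDθ hg (Real.rpow_lt_one_of_one_lt_of_neg hb1 (by linarith))
  set c := ⌈C₀⌉₊
  set e := ⌈2 * κ⌉₊
  refine ⟨(6 * d + 80) + (e + 27 + 3 * c) + C₀, by positivity, ?_⟩
  intro α β hα hβ lstar hl ε hε _ f hf hnorm
  set n := 2 * (α + β) with hn
  have hn' : 2 * κ * ((α : ℝ) + β) = κ * n := by rw [hn]; push_cast; ring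
  rw [hn'] at hl
  have hnl : n ≤ lstar := by
    rw [hl]
    exact Nat.le_floor (le_mul_of_one_le_left (by positivity) hκ1)
  obtain ⟨K, rfl⟩ := Nat.exists_eq_add_of_le hnl
  have hgK : ((b : ℝ) ^ (-γ)) ^ (n + K + 1) ≤ θ ^ n := by
    rw [hθ, ← Real.rpow_mul_natCast hb'.le, ← Real.rpow_mul_natCast hb'.le]
    refine Real.rpow_le_rpow_of_exponent_le hb1.le ?_
    have h1 := Nat.lt_floor_add_one (κ * n)
    rw [← hl] at h1
    have h2 := mul_lt_mul_of_pos_left h1 hγ0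
    rw [← mul_assoc, hκγ] at h2
    push_cast at h2 ⊢
    linarith
  obtain ⟨y, z, hcost, herr⟩ := happrox f (hsmooth f hf hnorm) n K hgK
  have hβ1 : 1 + β ≤ b ^ (d * β) := by
    calc 1 + β ≤ 2 ^ β := by rw [add_comm]; exact Nat.lt_two_pow_self
      _ ≤ b ^ β := Nat.pow_le_pow_left hb _
      _ ≤ b ^ (d * β) := Nat.pow_le_pow_right hb0 (Nat.le_mul_of_pos_left _ hd)
  have hr : n + K ≤ e * b ^ (d * β) * α := by
    have h1 : α + β ≤ b ^ (d * β) * α := by nlinarith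
    have h2 : ((n + K : ℕ) : ℝ) ≤ e * ((α : ℝ) + β) := by
      calc ((n + K : ℕ) : ℝ) ≤ κ * n := hl ▸ Nat.floor_le (by positivity)
        _ = 2 * κ * ((α : ℝ) + β) := hn'.symm
        _ ≤ _ := by gcongr; exact Nat.le_ceil _
    calc n + K ≤ e * (α + β) := by exact_mod_cast h2
      _ ≤ _ := by rw [mul_assoc]; exact Nat.mul_le_mul_left _ h1
  have hcost' := hcost.trans (mul_le_mul_of_nonneg_right (Nat.le_ceil C₀)
    (by positivity : (0 : ℝ) ≤ ((b ^ d : ℕ) : ℝ) ^ n))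
  rw [← Nat.cast_pow, ← Nat.cast_mul, Nat.cast_le] at hcost'
  obtain ⟨g, hgN, hgx⟩ := exists_network_forest hd hb0 hε hn rfl hr hρ (θ ^ n) hcost'
  have hbα : 0 < b ^ (d * α) := by positivity
  have hbβ : 0 < b ^ (d * β) := by positivity
  refine ⟨_, _, ?_, ?_, ?_, ?_, g, hgN, ?_⟩
  · exact Nat.mul_pos (by omega) hbα
  · omega
  · push_cast
    refine mul_le_mul_of_nonneg_right ?_ (by positivity)
    have : (0 : ℝ) ≤ (e + 27 + 3 * c) + C₀ := by positivity
    linarith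
  · push_cast
    have h1 : (e * (b : ℝ) ^ (d * β) + 27 * b ^ (d * β) + 3 * (c * b ^ (d * β))) =
        (e + 27 + 3 * c) * (b : ℝ) ^ (d * β) := by ring
    rw [h1]
    refine mul_le_mul_of_nonneg_right ?_ (by positivity)
    have : (0 : ℝ) ≤ (6 * d + 80) + C₀ := by positivity
    linarith
  · have h1 : eLpNorm (fun x => f x - g x 0) p
        (volume.restrict (goodRegion d b (n + K) ε)) =
        eLpNorm (fun x => f x - (θ ^ n *
          ∑ u ∈ range (cubeIndex d b (n + K) x / (b ^ d) ^ K + 1), (z u : ℝ) +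
          ∑ k ∈ range K, θ ^ n * ρ ^ (K - k) * y k (cubeIndex d b (n + K) x / (b ^ d) ^ k))) p
          (volume.restrict (goodRegion d b (n + K) ε)) := by
      refine eLpNorm_congr_ae ?_
      filter_upwards [ae_restrict_mem measurableSet_goodRegion] with x hx
      rw [hgx x hx]
    rw [h1]
    refine (eLpNorm_mono_measure _ (Measure.restrict_mono (goodRegion_subset hb0 hε) le_rfl)).trans
      (herr.trans (ENNReal.ofReal_le_ofReal ?_))
    have h2 : θ ^ n = (b : ℝ) ^ (-(2 * s) * ((α : ℝ) + β)) := by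
      rw [hθ, ← Real.rpow_mul_natCast hb'.le, hn]
      congr 1
      push_cast
      ring
    rw [h2]
    refine mul_le_mul_of_nonneg_right ?_ (by positivity)
    have : (0 : ℝ) ≤ (6 * d + 80) + (e + 27 + 3 * c) := by positivity
    linarith
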